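/- arXiv:1811.08130 — 11 statements merged into one kernel-verified Lean document; each statement's English description precedes it below -/
import Mathlib

section
/- Let u₁ ∈ C²([0,1], ℂ) and u₂ ∈ C¹([0,1], ℂ) with u₁'(0) = 0. Define v₁(ρ) = −ρ u₁'(ρ) − (3/2) u₁(ρ) + u₂(ρ) on [0,1] and v₂(ρ) = u₁''(ρ) + (4/ρ) u₁'(ρ) − ρ u₂'(ρ) − (5/2) u₂(ρ) on (0,1]. Then Re( ∫₀¹ v₁'(ρ) conj(u₁'(ρ)) ρ⁴ dρ + ∫₀¹ v₂(ρ) conj(u₂(ρ)) ρ⁴ dρ + v₁(1) conj(u₁(1)) ) ≤ −|u₁(1)|² ≤ 0. (All integrals converge absolutely; the factor ρ⁴ compensates the singular coefficient 4/ρ.) -/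
open Set ComplexConjugate

/-- The radial energy flux of `(w, u)`, whose derivative is the real part of the energy density
of the free wave operator. -/
lemma hasDerivAt_energyFlux {w u : ℝ → ℂ} {w' u' : ℂ} {x : ℝ}
    (hw : HasDerivAt w w' x) (hu : HasDerivAt u u' x) :
    HasDerivAt
      (fun ρ : ℝ => (-((ρ:ℂ)^5 / 2) * (w ρ * conj (w ρ) + u ρ * conj (u ρ))
        + (ρ:ℂ)^4 * (w ρ * conj (u ρ))).re)
      ((-(w x) - (x:ℂ) * w' - (3/2) * w x + u') * conj (w x) * (x:ℂ)^4
        + (w' + (4/(x:ℂ)) * w x - (x:ℂ) * u' - (5/2) * u x) * conj (u x) * (x:ℂ)^4).re x := by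
  have hx : HasDerivAt (fun ρ : ℝ => (ρ:ℂ)) 1 x := Complex.ofRealCLM.hasDerivAt
  have hwc : HasDerivAt (fun ρ => conj (w ρ)) (conj w') x := hw.star
  have huc : HasDerivAt (fun ρ => conj (u ρ)) (conj u') x := hu.star
  have h := (((hx.pow 5).div_const 2).neg.mul ((hw.mul hwc).add (hu.mul huc))).add
    ((hx.pow 4).mul (hw.mul huc))
  refine (Complex.reCLM.hasFDerivAt.comp_hasDerivAt x h).congr_deriv ?_
  have hdiv : 4 / (x:ℂ) * (x:ℂ)^4 = 4 * (x:ℂ)^3 := by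
    rcases eq_or_ne (x:ℂ) 0 with h0 | h0
    · simp [h0]
    · field_simp
  rw [show (w' + (4/(x:ℂ)) * w x - (x:ℂ) * u' - (5/2) * u x) * conj (u x) * (x:ℂ)^4
      = (w' - (x:ℂ) * u' - (5/2) * u x) * conj (u x) * (x:ℂ)^4
        + w x * conj (u x) * (4 / (x:ℂ) * (x:ℂ)^4) by ring, hdiv]
  simp [← Complex.ofReal_pow]
  ring

/-- Dissipativity of the free wave operator in similarity coordinates:
for `u₁ ∈ C²([0,1],ℂ)`, `u₂ ∈ C¹([0,1],ℂ)` with `u₁'(0) = 0`, setting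
`v₁ = -ρu₁' - (3/2)u₁ + u₂` (with derivative `v₁' = -u₁' - ρu₁'' - (3/2)u₁' + u₂'`)
and `v₂ = u₁'' + (4/ρ)u₁' - ρu₂' - (5/2)u₂`, one has
`Re(∫₀¹ v₁' conj(u₁') ρ⁴ + ∫₀¹ v₂ conj(u₂) ρ⁴ + v₁(1) conj(u₁(1))) ≤ -|u₁(1)|² ≤ 0`. -/
theorem dissipativity_free_operator
    (u₁ u₁' u₁'' u₂ u₂' : ℝ → ℂ)
    (hu₁ : ∀ ρ ∈ Icc (0:ℝ) 1, HasDerivWithinAt u₁ (u₁' ρ) (Icc (0:ℝ) 1) ρ)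
    (hu₁' : ∀ ρ ∈ Icc (0:ℝ) 1, HasDerivWithinAt u₁' (u₁'' ρ) (Icc (0:ℝ) 1) ρ)
    (hu₁'' : ContinuousOn u₁'' (Icc (0:ℝ) 1))
    (hu₂ : ∀ ρ ∈ Icc (0:ℝ) 1, HasDerivWithinAt u₂ (u₂' ρ) (Icc (0:ℝ) 1) ρ)
    (hu₂' : ContinuousOn u₂' (Icc (0:ℝ) 1))
    (hzero : u₁' 0 = 0) :
    ((∫ ρ in (0:ℝ)..1,
        (-(u₁' ρ) - (ρ:ℂ) * u₁'' ρ - (3/2) * u₁' ρ + u₂' ρ) * conj (u₁' ρ) * (ρ:ℂ)^4)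
      + (∫ ρ in (0:ℝ)..1,
        (u₁'' ρ + (4/(ρ:ℂ)) * u₁' ρ - (ρ:ℂ) * u₂' ρ - (5/2) * u₂ ρ) * conj (u₂ ρ) * (ρ:ℂ)^4)
      + (-(u₁' 1) - (3/2) * u₁ 1 + u₂ 1) * conj (u₁ 1)).re
      ≤ -‖u₁ 1‖^2 ∧ -‖u₁ 1‖^2 ≤ (0:ℝ) := by
  refine ⟨?_, by simp⟩
  have hcw : ContinuousOn u₁' (Icc 0 1) := fun ρ hρ => (hu₁' ρ hρ).continuousWithinAt
  have hcu : ContinuousOn u₂ (Icc 0 1) := fun ρ hρ => (hu₂ ρ hρ).continuousWithinAt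
  have hcwc : ContinuousOn (fun ρ => conj (u₁' ρ)) (Icc 0 1) := hcw.star
  have hcuc : ContinuousOn (fun ρ => conj (u₂ ρ)) (Icc 0 1) := hcu.star
  have hcx : ContinuousOn (fun ρ : ℝ => (ρ:ℂ)) (Icc 0 1) := Complex.continuous_ofReal.continuousOn
  have hi₁ : IntervalIntegrable (fun ρ : ℝ =>
      (-(u₁' ρ) - (ρ:ℂ) * u₁'' ρ - (3/2) * u₁' ρ + u₂' ρ) * conj (u₁' ρ) * (ρ:ℂ)^4)
      MeasureTheory.volume 0 1 := by
    apply ContinuousOn.intervalIntegrable_of_Icc zero_le_one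
    fun_prop
  have hi₂ : IntervalIntegrable (fun ρ : ℝ =>
      (u₁'' ρ + (4/(ρ:ℂ)) * u₁' ρ - (ρ:ℂ) * u₂' ρ - (5/2) * u₂ ρ) * conj (u₂ ρ) * (ρ:ℂ)^4)
      MeasureTheory.volume 0 1 := by
    have heq : (fun ρ : ℝ =>
        (u₁'' ρ + (4/(ρ:ℂ)) * u₁' ρ - (ρ:ℂ) * u₂' ρ - (5/2) * u₂ ρ) * conj (u₂ ρ) * (ρ:ℂ)^4)
        = fun ρ : ℝ => ((u₁'' ρ - (ρ:ℂ) * u₂' ρ - (5/2) * u₂ ρ) * (ρ:ℂ)^4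
          + 4 * (ρ:ℂ)^3 * u₁' ρ) * conj (u₂ ρ) := by
      funext ρ
      rcases eq_or_ne (ρ:ℂ) 0 with h0 | h0
      · simp [h0]
      · field_simp
        ring
    rw [heq]
    apply ContinuousOn.intervalIntegrable_of_Icc zero_le_one
    fun_prop
  have hint := hi₁.add hi₂
  have hre := Complex.reCLM.intervalIntegral_comp_comm hint
  have hflux := intervalIntegral.integral_eq_sub_of_hasDerivAt_of_le zero_le_one
    (f := fun ρ : ℝ => (-((ρ:ℂ)^5 / 2) * (u₁' ρ * conj (u₁' ρ) + u₂ ρ * conj (u₂ ρ))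
        + (ρ:ℂ)^4 * (u₁' ρ * conj (u₂ ρ))).re)
    (Complex.continuous_re.comp_continuousOn (by fun_prop))
    (fun x hx => hasDerivAt_energyFlux
      ((hu₁' x (Ioo_subset_Icc_self hx)).hasDerivAt (Icc_mem_nhds hx.1 hx.2))
      ((hu₂ x (Ioo_subset_Icc_self hx)).hasDerivAt (Icc_mem_nhds hx.1 hx.2)))
    ⟨Complex.reCLM.integrable_comp hint.1, Complex.reCLM.integrable_comp hint.2⟩
  rw [← intervalIntegral.integral_add hi₁ hi₂, Complex.add_re]
  have htotal := hre.symm.trans hflux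
  rw [Complex.reCLM_apply] at htotal
  rw [htotal, ← Complex.normSq_eq_norm_sq, Complex.normSq_apply]
  simp
  nlinarith [sq_nonneg ((u₂ 1).re - (u₁' 1).re - (u₁ 1).re),
    sq_nonneg ((u₂ 1).im - (u₁' 1).im - (u₁ 1).im)]
end

section
/- For every F ∈ C^∞([0,1], ℂ) there exists u ∈ C²([0,1], ℂ) with u'(0) = 0 such that (−1 + ρ²) u''(ρ) + (−4/ρ + 7ρ) u'(ρ) + (35/4) u(ρ) = F(ρ) for all ρ ∈ (0,1). -/
open Set

/-- Differentiation under the integral sign for weighted averages of dilates about `c`. -/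
lemma hasDerivAt_integral_dilation {φ : ℝ → ℝ} (hφ : Continuous φ) (c : ℝ) {g : ℝ → ℂ}
    (hg : ContDiff ℝ 1 g) (x : ℝ) :
    HasDerivAt (fun y => ∫ t in (0:ℝ)..1, φ t • g (c + t * (y - c)))
      (∫ t in (0:ℝ)..1, (φ t * t) • deriv g (c + t * (x - c))) x := by
  have hg0 : Continuous g := hg.continuous
  have hg1 : Continuous (deriv g) := hg.continuous_deriv le_rfl
  have hcont : Continuous (fun p : ℝ × ℝ => (φ p.2 * p.2) • deriv g (c + p.2 * (p.1 - c))) := by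
    fun_prop
  obtain ⟨M, hM⟩ := ((isCompact_Icc (a := x - 1) (b := x + 1)).prod
    (isCompact_Icc (a := (0:ℝ)) (b := 1))).exists_bound_of_continuousOn hcont.continuousOn
  refine (intervalIntegral.hasDerivAt_integral_of_dominated_loc_of_deriv_le
    (F := fun y t => φ t • g (c + t * (y - c)))
    (F' := fun y t => (φ t * t) • deriv g (c + t * (y - c))) (bound := fun _ => M)
    (Icc_mem_nhds (by linarith : x - 1 < x) (by linarith : x < x + 1)) ?_ ?_ ?_ ?_ ?_ ?_).2
  · refine Filter.Eventually.of_forall fun y => Continuous.aestronglyMeasurable ?_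
    fun_prop
  · refine Continuous.intervalIntegrable ?_ _ _
    fun_prop
  · refine Continuous.aestronglyMeasurable ?_
    fun_prop
  · refine Filter.Eventually.of_forall fun t ht y hy => hM (y, t) ⟨hy, ?_⟩
    rw [uIoc_of_le zero_le_one] at ht
    exact ⟨ht.1.le, ht.2⟩
  · exact intervalIntegrable_const
  · refine Filter.Eventually.of_forall fun t _ y _ => ?_
    have h1 : HasDerivAt (fun y : ℝ => c + t * (y - c)) t y := by
      simpa using (((hasDerivAt_id y).sub_const c).const_mul t).const_add c
    have h2 := ((hg.differentiable one_ne_zero (c + t * (y - c))).hasDerivAt.scomp y h1).const_smul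
      (φ t)
    rw [mul_smul]
    exact h2

/-- Weighted averages of dilates inherit the regularity of the function. -/
lemma contDiff_integral_dilation (c : ℝ) (n : ℕ) {φ : ℝ → ℝ} (hφ : Continuous φ) {g : ℝ → ℂ}
    (hg : ContDiff ℝ n g) :
    ContDiff ℝ n (fun y => ∫ t in (0:ℝ)..1, φ t • g (c + t * (y - c))) := by
  induction n generalizing φ g with
  | zero =>
    have hg0 : Continuous g := hg.continuous
    rw [Nat.cast_zero, contDiff_zero]
    apply intervalIntegral.continuous_parametric_intervalIntegral_of_continuous'
    unfold Function.uncurry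
    fun_prop
  | succ n ih =>
    have hd := hasDerivAt_integral_dilation hφ c (hg.of_le (by norm_cast; omega))
    push_cast at hg ⊢
    rw [contDiff_succ_iff_deriv] at hg ⊢
    refine ⟨fun x => (hd x).differentiableAt, by simp, ?_⟩
    rw [funext fun x => (hd x).deriv]
    exact ih (hφ.mul continuous_id) hg.2.2

/-- The regular solution of the Fuchsian equation `(ρ - c) v' + β v = g`. -/
lemma exists_contDiff_fuchsian (c : ℝ) {β : ℝ} (hβ : 1 ≤ β) (n : ℕ) (hn : 1 ≤ n) {g : ℝ → ℂ}
    (hg : ContDiff ℝ n g) :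
    ∃ v : ℝ → ℂ, ContDiff ℝ n v ∧
      ∀ ρ : ℝ, ((ρ : ℂ) - c) * deriv v ρ + β * v ρ = g ρ := by
  have hφ : Continuous (fun t : ℝ => t ^ (β - 1)) :=
    Real.continuous_rpow_const (by linarith)
  have hg' : ContDiff ℝ 1 g := hg.of_le (by exact_mod_cast hn)
  have hg0 : Continuous g := hg.continuous
  have hg1 : Continuous (deriv g) := hg'.continuous_deriv le_rfl
  refine ⟨_, contDiff_integral_dilation c n hφ hg, fun ρ => ?_⟩
  rw [(hasDerivAt_integral_dilation hφ c hg' ρ).deriv]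
  have hpow : ∀ t ∈ uIcc (0:ℝ) 1, t ^ (β - 1) * t = t ^ β := by
    intro t ht
    rw [uIcc_of_le zero_le_one] at ht
    conv_lhs => rw [← Real.rpow_add_one' ht.1 (by linarith)]
    simp
  have hftc : ∫ t in (0:ℝ)..1, ((ρ - c) • ((t ^ (β - 1) * t) • deriv g (c + t * (ρ - c)))
      + β • (t ^ (β - 1) • g (c + t * (ρ - c)))) = g ρ := by
    rw [intervalIntegral.integral_eq_sub_of_hasDerivAt
      (f := fun t => (t ^ β) • g (c + t * (ρ - c)))]
    · simp [Real.zero_rpow (by linarith : β ≠ 0)]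
    · intro t ht
      have h1 : HasDerivAt (fun t : ℝ => c + t * (ρ - c)) (ρ - c) t := by
        simpa using ((hasDerivAt_id t).mul_const (ρ - c)).const_add c
      have h2 := (hg'.differentiable one_ne_zero (c + t * (ρ - c))).hasDerivAt.scomp t h1
      have h3 := (Real.hasDerivAt_rpow_const (x := t) (p := β) (Or.inr hβ)).smul h2
      refine h3.congr_deriv ?_
      rw [hpow t ht]
      simp only [Function.comp_apply, smul_smul]
      rw [mul_comm (ρ - c)]
    · refine Continuous.intervalIntegrable ?_ _ _
      fun_prop
  rw [intervalIntegral.integral_add, intervalIntegral.integral_smul,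
    intervalIntegral.integral_smul] at hftc
  · rw [← hftc]
    simp [Complex.real_smul]
  · refine Continuous.intervalIntegrable ?_ _ _
    fun_prop
  · refine Continuous.intervalIntegrable ?_ _ _
    fun_prop

/-- A `C^n` function on a compact interval extends to a `C^n` function on the line. -/
lemma ContDiffOn.exists_contDiff_extension_Icc {a b : ℝ} (hab : a < b) (n : ℕ) {f : ℝ → ℂ}
    (hf : ContDiffOn ℝ n f (Icc a b)) :
    ∃ g : ℝ → ℂ, ContDiff ℝ n g ∧ EqOn g f (Icc a b) := by
  induction n generalizing f with
  | zero =>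
    refine ⟨IccExtend hab.le ((Icc a b).domRestrict f), ?_, ?_⟩
    · rw [Nat.cast_zero, contDiff_zero]
      exact (continuousOn_iff_continuous_domRestrict.1 hf.continuousOn).Icc_extend'
    · intro x hx
      rw [IccExtend_of_mem _ _ hx]
      rfl
  | succ n ih =>
    push_cast at hf
    rw [contDiffOn_succ_iff_derivWithin (uniqueDiffOn_Icc hab)] at hf
    obtain ⟨h, hh, hhf⟩ := ih hf.2.2
    have hd : ∀ x, HasDerivAt (fun x => f a + ∫ t in a..x, h t) (h x) x := fun x =>
      (intervalIntegral.integral_hasDerivAt_right (hh.continuous.intervalIntegrable _ _)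
        (hh.continuous.stronglyMeasurableAtFilter _ _) hh.continuous.continuousAt).const_add _
    refine ⟨fun x => f a + ∫ t in a..x, h t, ?_, ?_⟩
    · push_cast
      rw [contDiff_succ_iff_deriv]
      refine ⟨fun x => (hd x).differentiableAt, by simp, ?_⟩
      rwa [funext fun x => (hd x).deriv]
    · refine eq_of_derivWithin_eq (fun x _ => (hd x).differentiableAt.differentiableWithinAt)
        hf.1 (fun x hx => ?_) (by simp)
      have hx' : x ∈ Icc a b := Ico_subset_Icc_self hx
      rw [(hd x).hasDerivWithinAt.derivWithin (uniqueDiffOn_Icc hab x hx'), hhf hx']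

/-- For `C²` data, the equation `(-1 + ρ²) w'' + 5 ρ w' + (15/4) w = g` has a solution on `(0,1)`
of the form `w(ρ) = ρ k(ρ)` with `k` of class `C²` on the line. -/
lemma exists_contDiff_wave_one_dim {g : ℝ → ℂ} (hg : ContDiff ℝ 2 g) :
    ∃ k : ℝ → ℂ, ContDiff ℝ 2 k ∧ ∀ ρ ∈ Ioo (0:ℝ) 1,
      (-1 + (ρ:ℂ) ^ 2) * (2 * deriv k ρ + ρ * deriv (deriv k) ρ) +
        5 * ρ * (k ρ + ρ * deriv k ρ) + (15 / 4) * (ρ * k ρ) = g ρ := by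
  obtain ⟨z, hz, hzg⟩ := exists_contDiff_fuchsian 1 (β := 5 / 2) (by norm_num) 2 (by norm_num) hg
  have hpow : ∀ p : ℝ, ContDiffOn ℝ 2 (fun s : ℝ => (((1 + s) ^ p : ℝ) : ℂ)) (Icc 0 1) := by
    intro p
    refine Complex.ofRealCLM.contDiff.comp_contDiffOn
      (ContDiffOn.rpow_const_of_ne (by fun_prop) fun x hx => ?_)
    have := hx.1
    positivity
  obtain ⟨ψ, hψ, hψe⟩ := (hpow (-3 / 2)).exists_contDiff_extension_Icc zero_lt_one 2
  obtain ⟨q, hq, hqe⟩ :=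
    ((hpow (1 / 2)).mul hz.contDiffOn).exists_contDiff_extension_Icc zero_lt_one 2
  obtain ⟨h, hh, hhq⟩ := exists_contDiff_fuchsian 0 (β := 1) le_rfl 2 (by norm_num) hq
  have hk : ContDiff ℝ 2 (fun s => ψ s * h s) := hψ.mul hh
  refine ⟨fun s => ψ s * h s, hk, ?_⟩
  set k : ℝ → ℂ := fun s => ψ s * h s with hkdef
  have hk1 : Differentiable ℝ k := hk.differentiable two_ne_zero
  have hk2 : Differentiable ℝ (deriv k) := hk.differentiable_deriv_two
  have hz1 : Differentiable ℝ z := hz.differentiable two_ne_zero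
  have hX : ∀ ρ : ℝ, HasDerivAt (fun ρ : ℝ => (ρ : ℂ)) 1 ρ := fun ρ => by
    simpa using (hasDerivAt_id ρ).ofReal_comp
  have first : ∀ ρ ∈ Ioo (0:ℝ) 1,
      (1 + (ρ:ℂ)) * (k ρ + ρ * deriv k ρ) + 3 / 2 * (ρ * k ρ) = z ρ := by
    intro ρ hρ
    have hpos : 0 < 1 + ρ := by linarith [hρ.1]
    have hψd : HasDerivAt ψ ((((-3 / 2) * (1 + ρ) ^ (-3 / 2 - 1 : ℝ) : ℝ)) : ℂ) ρ := by
      have h1 : HasDerivAt (fun s : ℝ => (1 + s) ^ (-3 / 2 : ℝ))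
          ((-3 / 2) * (1 + ρ) ^ (-3 / 2 - 1 : ℝ)) ρ := by
        simpa using ((hasDerivAt_id ρ).const_add 1).rpow_const (p := -3 / 2) (Or.inl hpos.ne')
      exact h1.ofReal_comp.congr_of_eventuallyEq (hψe.eventuallyEq_of_mem (Icc_mem_nhds hρ.1 hρ.2))
    have hkd := (hψd.mul (hh.differentiable two_ne_zero ρ).hasDerivAt).deriv
    have hψρ : ψ ρ = (((1 + ρ) ^ (-3 / 2 : ℝ) : ℝ) : ℂ) := hψe (Ioo_subset_Icc_self hρ)
    have hqρ : q ρ = (((1 + ρ) ^ (1 / 2 : ℝ) : ℝ) : ℂ) * z ρ := hqe (Ioo_subset_Icc_self hρ)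
    have e1 : (1 + (ρ:ℂ)) * (((1 + ρ) ^ (-3 / 2 - 1 : ℝ) : ℝ) : ℂ) = ψ ρ := by
      rw [hψρ, Real.rpow_sub_one hpos.ne']
      push_cast
      have : (1 + (ρ:ℂ)) ≠ 0 := by exact_mod_cast hpos.ne'
      field_simp
    have e2 : (1 + (ρ:ℂ)) * ψ ρ * (((1 + ρ) ^ (1 / 2 : ℝ) : ℝ) : ℂ) = 1 := by
      have e : (1 + ρ) * (1 + ρ) ^ (-3 / 2 : ℝ) * (1 + ρ) ^ (1 / 2 : ℝ) = 1 := by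
        rw [mul_assoc, ← Real.rpow_add hpos, show (-3 / 2 + 1 / 2 : ℝ) = -1 by norm_num,
          Real.rpow_neg_one, mul_inv_cancel₀ hpos.ne']
      rw [hψρ]
      exact_mod_cast congrArg Complex.ofReal e
    have e3 := hhq ρ
    rw [hqρ] at e3
    have hkd' : deriv k ρ = _ := hkd
    rw [hkd']
    simp only [hkdef]
    push_cast at e3 ⊢
    linear_combination ((1 + (ρ:ℂ)) * ψ ρ) * e3 + z ρ * e2 - (3 / 2) * ρ * h ρ * e1
  intro ρ hρ
  have hd : HasDerivAt (fun ρ : ℝ => (1 + (ρ:ℂ)) * (k ρ + ρ * deriv k ρ) + 3 / 2 * (ρ * k ρ))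
      _ ρ :=
    (((hX ρ).const_add 1).fun_mul
      ((hk1 ρ).hasDerivAt.fun_add ((hX ρ).fun_mul (hk2 ρ).hasDerivAt))).fun_add
      (((hX ρ).fun_mul (hk1 ρ).hasDerivAt).const_mul (3 / 2))
  have second := (hd.congr_of_eventuallyEq (Filter.eventuallyEq_of_mem
    (Ioo_mem_nhds hρ.1 hρ.2) fun s hs => (first s hs).symm)).unique (hz1 ρ).hasDerivAt
  have third := hzg ρ
  have f := first ρ hρ
  push_cast at third
  linear_combination third + (ρ - 1) * second + 5 / 2 * f

/-- Density-of-range step (λ = 1) for the free wave operator in similarity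
coordinates: for every `F ∈ C^∞([0,1],ℂ)` there is `u ∈ C²([0,1],ℂ)` with
`u'(0) = 0` solving `(-1+ρ²)u'' + (-4/ρ + 7ρ)u' + (35/4)u = F` on `(0,1)`. -/
theorem resolvent_ode_solvable
    (F : ℝ → ℂ) (hF : ContDiffOn ℝ (⊤ : ℕ∞) F (Icc (0:ℝ) 1)) :
    ∃ u u' u'' : ℝ → ℂ,
      (∀ ρ ∈ Icc (0:ℝ) 1, HasDerivWithinAt u (u' ρ) (Icc (0:ℝ) 1) ρ) ∧
      (∀ ρ ∈ Icc (0:ℝ) 1, HasDerivWithinAt u' (u'' ρ) (Icc (0:ℝ) 1) ρ) ∧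
      ContinuousOn u'' (Icc (0:ℝ) 1) ∧
      u' 0 = 0 ∧
      ∀ ρ ∈ Ioo (0:ℝ) 1,
        (-1 + (ρ:ℂ)^2) * u'' ρ + (-4/(ρ:ℂ) + 7*(ρ:ℂ)) * u' ρ + (35/4) * u ρ = F ρ := by
  obtain ⟨f, hf, hfF⟩ :=
    (contDiffOn_infty.1 hF 3).exists_contDiff_extension_Icc zero_lt_one 3
  have hf1 : Differentiable ℝ f := hf.differentiable (by norm_num)
  have hXc : ContDiff ℝ 2 (fun ρ : ℝ => (ρ : ℂ)) := Complex.ofRealCLM.contDiff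
  have hf' : ContDiff ℝ 2 (deriv f) := by
    have h3 : ContDiff ℝ (2 + 1) f := by
      convert hf using 1
      norm_num
    exact (contDiff_succ_iff_deriv.1 h3).2.2
  have hf2 : ContDiff ℝ 2 f := hf.of_le (by norm_cast)
  obtain ⟨k, hk, hke⟩ := exists_contDiff_wave_one_dim
    (g := fun ρ => (ρ : ℂ) ^ 2 * deriv f ρ + 3 * ρ * f ρ)
    (((hXc.pow 2).mul hf').add ((contDiff_const.mul hXc).mul hf2))
  obtain ⟨u, hu, huk⟩ := exists_contDiff_fuchsian 0 (β := 3) (by norm_num) 2 (by norm_num) hk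
  have hk1 : Differentiable ℝ k := hk.differentiable two_ne_zero
  have hk2 : Differentiable ℝ (deriv k) := hk.differentiable_deriv_two
  have hu1 : Differentiable ℝ u := hu.differentiable two_ne_zero
  have hu2 : Differentiable ℝ (deriv u) := hu.differentiable_deriv_two
  have hu3 : Continuous (deriv (deriv u)) := by
    have h2 : ContDiff ℝ (1 + 1) u := by
      convert hu using 1
      norm_num
    exact (contDiff_succ_iff_deriv.1 h2).2.2.continuous_deriv le_rfl
  have hX : ∀ ρ : ℝ, HasDerivAt (fun ρ : ℝ => (ρ : ℂ)) 1 ρ := fun ρ => by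
    simpa using (hasDerivAt_id ρ).ofReal_comp
  replace huk : ∀ ρ : ℝ, (ρ : ℂ) * deriv u ρ + 3 * u ρ = k ρ := fun ρ => by
    simpa using huk ρ
  have huk' : ∀ ρ : ℝ, (ρ : ℂ) * deriv (deriv u) ρ + 4 * deriv u ρ = deriv k ρ := by
    intro ρ
    have hd := ((hX ρ).fun_mul (hu2 ρ).hasDerivAt).fun_add ((hu1 ρ).hasDerivAt.const_mul 3)
    rw [funext huk] at hd
    rw [hd.deriv]
    ring
  have hQd : ∀ ρ : ℝ, HasDerivAt (fun ρ : ℝ => ((ρ : ℂ) ^ 3 - ρ) * (k ρ + ρ * deriv k ρ) +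
      ((2 * (ρ : ℂ) ^ 2 + 1) * (ρ * k ρ)) - ((ρ : ℂ) ^ 3 * u ρ) / 4 - (ρ : ℂ) ^ 3 * f ρ) _ ρ :=
    fun ρ => (((((hX ρ).fun_pow 3).fun_sub (hX ρ)).fun_mul
      ((hk1 ρ).hasDerivAt.fun_add ((hX ρ).fun_mul (hk2 ρ).hasDerivAt))).fun_add
      (((((hX ρ).fun_pow 2).const_mul 2).add_const 1).fun_mul
        ((hX ρ).fun_mul (hk1 ρ).hasDerivAt))).fun_sub
      ((((hX ρ).fun_pow 3).fun_mul (hu1 ρ).hasDerivAt).div_const 4) |>.fun_sub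
      (((hX ρ).fun_pow 3).fun_mul (hf1 ρ).hasDerivAt)
  have hQ := constant_of_has_deriv_right_zero (a := 0) (b := 1)
    (fun ρ _ => (hQd ρ).continuousAt.continuousWithinAt) (fun ρ hρ => by
      refine HasDerivAt.hasDerivWithinAt ((hQd ρ).congr_deriv ?_)
      rcases hρ.1.eq_or_lt with rfl | h0
      · simp
      · have e := hke ρ ⟨h0, hρ.2⟩
        have e' := huk ρ
        push_cast
        linear_combination (ρ : ℂ) * e - (ρ : ℂ) ^ 2 / 4 * e')
  have ode : ∀ ρ ∈ Ioo (0:ℝ) 1, (ρ : ℂ) * (-1 + (ρ:ℂ) ^ 2) * deriv (deriv u) ρ +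
      (-4 + 7 * (ρ:ℂ) ^ 2) * deriv u ρ + (35 / 4) * ρ * u ρ = ρ * f ρ := by
    intro ρ hρ
    have h0 : (ρ : ℂ) ≠ 0 := by exact_mod_cast hρ.1.ne'
    have e := hQ ρ (Ioo_subset_Icc_self hρ)
    simp only [← huk, ← huk'] at e
    simp at e
    refine mul_left_cancel₀ (pow_ne_zero 2 h0) ?_
    linear_combination e
  refine ⟨u, deriv u, deriv (deriv u), fun ρ _ => (hu1 ρ).hasDerivAt.hasDerivWithinAt,
    fun ρ _ => (hu2 ρ).hasDerivAt.hasDerivWithinAt, hu3.continuousOn, ?_, fun ρ hρ => ?_⟩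
  · have hc : EqOn (fun ρ : ℝ => (ρ : ℂ) * (-1 + (ρ:ℂ) ^ 2) * deriv (deriv u) ρ +
        (-4 + 7 * (ρ:ℂ) ^ 2) * deriv u ρ + (35 / 4) * ρ * u ρ) (fun ρ : ℝ => ρ * f ρ)
        (closure (Ioo (0:ℝ) 1)) := by
      have := hu1.continuous
      have := hu2.continuous
      have := hf1.continuous
      exact EqOn.closure ode (by fun_prop) (by fun_prop)
    rw [closure_Ioo zero_ne_one] at hc
    simpa using hc (left_mem_Icc.2 zero_le_one)
  · have h0 : (ρ : ℂ) ≠ 0 := by exact_mod_cast hρ.1.ne'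
    rw [← hfF (Ioo_subset_Icc_self hρ)]
    refine mul_left_cancel₀ h0 ?_
    rw [← ode ρ hρ]
    field_simp
end

section
/- Let λ ∈ ℂ with Re λ > 0 and λ ≠ 1. Suppose u ∈ C²((0,1), ℂ) satisfies the ODE −(1−ρ²) u''(ρ) + (−4/ρ + (2λ+5)ρ) u'(ρ) + ((λ + 5/2)(λ + 3/2) − 35/4) u(ρ) = 0 for all ρ ∈ (0,1), and suppose ∫₀¹ (|u(ρ)|² + |u'(ρ)|²) ρ⁴ dρ < ∞. Then u ≡ 0 on (0,1). -/
open Set MeasureTheory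

open Filter Topology in
/-- If `‖F x‖² / x` is dominated by an integrable function near `0`, then the limit of `F` at
`0⁺`, when it exists, vanishes. -/
theorem tendsto_nhdsGT_zero_limit_eq_zero {E : Type*} [NormedAddCommGroup E] {F : ℝ → E}
    {h : ℝ → ℝ} {L : E} (hh : IntegrableOn h (Ioo 0 1)) (hF : Tendsto F (𝓝[>] 0) (𝓝 L))
    (hle : ∀ x ∈ Ioo (0:ℝ) 1, ‖F x‖ ^ 2 ≤ x * h x) : L = 0 := by
  by_contra hL
  have hpos : 0 < ‖L‖ ^ 2 := by positivity
  have hlim : Tendsto (fun x => ‖F x‖ ^ 2) (𝓝[>] 0) (𝓝 (‖L‖ ^ 2)) := hF.norm.pow 2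
  have hev : ∀ᶠ x in 𝓝[>] (0:ℝ), ‖L‖ ^ 2 / 2 < ‖F x‖ ^ 2 :=
    hlim.eventually (lt_mem_nhds (by linarith))
  obtain ⟨d, hd, hsub⟩ := mem_nhdsGT_iff_exists_Ioo_subset.1 hev
  have hd0 : (0:ℝ) < d := hd
  have he : 0 < min d 1 := lt_min hd0 one_pos
  have hint : IntegrableOn (fun x : ℝ => x⁻¹) (Ioo 0 (min d 1)) := by
    refine Integrable.mono' (g := fun x => 2 / ‖L‖ ^ 2 * h x)
      (((hh.mono_set (Ioo_subset_Ioo_right (min_le_right d 1)))).const_mul _)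
      measurable_inv.aestronglyMeasurable ?_
    filter_upwards [ae_restrict_mem measurableSet_Ioo] with x hx
    have hx1 : x ∈ Ioo (0:ℝ) 1 := ⟨hx.1, hx.2.trans_le (min_le_right _ _)⟩
    have hFx : ‖L‖ ^ 2 / 2 < ‖F x‖ ^ 2 := hsub ⟨hx.1, hx.2.trans_le (min_le_left _ _)⟩
    have hlx := hle x hx1
    rw [Real.norm_of_nonneg (inv_nonneg.2 hx.1.le), inv_le_iff_one_le_mul₀ hx.1,
      div_mul_eq_mul_div, div_mul_eq_mul_div, le_div_iff₀ hpos]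
    nlinarith
  rw [← intervalIntegrable_iff_integrableOn_Ioo_of_le he.le, intervalIntegrable_inv_iff] at hint
  rcases hint with h0 | h0
  · exact he.ne h0
  · exact h0 left_mem_uIcc

open Filter Topology in
/-- The fundamental theorem of calculus on `(0, 1)` with boundary values that vanish because
`‖F x‖² / (x (1 - x))` is dominated by an integrable function. -/
theorem integral_deriv_eq_zero_of_sq_le {E : Type*} [NormedAddCommGroup E] [NormedSpace ℝ E]
    [CompleteSpace E] {F F' : ℝ → E} {h : ℝ → ℝ} (hh : IntegrableOn h (Ioo 0 1))
    (hderiv : ∀ x ∈ Ioo (0:ℝ) 1, HasDerivAt F (F' x) x) (hF' : IntegrableOn F' (Ioo 0 1))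
    (hle : ∀ x ∈ Ioo (0:ℝ) 1, ‖F x‖ ^ 2 ≤ x * (1 - x) * h x) :
    ∫ x in Ioo 0 1, F' x = 0 := by
  have hh0 : ∀ x ∈ Ioo (0:ℝ) 1, 0 ≤ h x := fun x hx =>
    nonneg_of_mul_nonneg_right ((sq_nonneg _).trans (hle x hx))
      (mul_pos hx.1 (sub_pos.2 hx.2))
  have hII : IntervalIntegrable F' volume 0 1 :=
    (intervalIntegrable_iff_integrableOn_Ioo_of_le zero_le_one).2 hF'
  have hcont : ContinuousOn (fun x => ∫ t in (0:ℝ)..x, F' t) (Icc 0 1) := by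
    have := intervalIntegral.continuousOn_primitive_interval (f := F') (a := 0) (b := 1)
      (μ := volume)
    rw [uIcc_of_le zero_le_one] at this
    exact this ((integrableOn_Icc_iff_integrableOn_Ioo).2 hF')
  have hsubI : ∀ {a b : ℝ}, a ∈ Icc (0:ℝ) 1 → b ∈ Icc (0:ℝ) 1 →
      IntervalIntegrable F' volume a b := fun {a b} ha hb => hII.mono_set (by
    rw [uIcc_of_le zero_le_one]; exact uIcc_subset_Icc ha hb)
  have hm : (1 / 2 : ℝ) ∈ Ioo (0:ℝ) 1 := by norm_num
  have hrep : ∀ x ∈ Ioo (0:ℝ) 1,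
      F x = (F (1 / 2) - ∫ t in (0:ℝ)..(1 / 2), F' t) + ∫ t in (0:ℝ)..x, F' t := by
    intro x hx
    have h1 : ∫ t in (1 / 2 : ℝ)..x, F' t = F x - F (1 / 2) :=
      intervalIntegral.integral_eq_sub_of_hasDerivAt
        (fun y hy => hderiv y ((Set.ordConnected_Ioo.uIcc_subset hm hx) hy))
        (hsubI (Ioo_subset_Icc_self hm) (Ioo_subset_Icc_self hx))
    have h2 := intervalIntegral.integral_add_adjacent_intervals
      (hsubI (left_mem_Icc.2 zero_le_one) (Ioo_subset_Icc_self hm))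
      (hsubI (Ioo_subset_Icc_self hm) (Ioo_subset_Icc_self hx))
    rw [← h2, h1]
    abel
  set c := F (1 / 2) - ∫ t in (0:ℝ)..(1 / 2), F' t
  have hlim0 : Tendsto F (𝓝[>] 0) (𝓝 (c + ∫ t in (0:ℝ)..0, F' t)) := by
    rw [← nhdsWithin_Ioo_eq_nhdsGT (zero_lt_one' ℝ)]
    refine Tendsto.congr' (eventually_nhdsWithin_of_forall fun x hx => (hrep x hx).symm) ?_
    exact tendsto_const_nhds.add
      ((hcont 0 (left_mem_Icc.2 zero_le_one)).mono_left (nhdsWithin_mono _ Ioo_subset_Icc_self))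
  have hlim1 : Tendsto F (𝓝[<] 1) (𝓝 (c + ∫ t in (0:ℝ)..1, F' t)) := by
    rw [← nhdsWithin_Ioo_eq_nhdsLT (zero_lt_one' ℝ)]
    refine Tendsto.congr' (eventually_nhdsWithin_of_forall fun x hx => (hrep x hx).symm) ?_
    exact tendsto_const_nhds.add
      ((hcont 1 (right_mem_Icc.2 zero_le_one)).mono_left (nhdsWithin_mono _ Ioo_subset_Icc_self))
  have hz0 := tendsto_nhdsGT_zero_limit_eq_zero hh hlim0 fun x hx =>
    (hle x hx).trans (by nlinarith [mul_nonneg (mul_nonneg hx.1.le hx.1.le) (hh0 x hx)])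
  have hhr : IntegrableOn (fun x => h (1 - x)) (Ioo 0 1) := by
    rw [← intervalIntegrable_iff_integrableOn_Ioo_of_le zero_le_one] at hh ⊢
    simpa using (hh.comp_sub_left 1).symm
  have hflip : Tendsto (fun x : ℝ => 1 - x) (𝓝[>] 0) (𝓝[<] 1) := by
    refine tendsto_nhdsWithin_iff.2 ⟨?_, eventually_nhdsWithin_of_forall fun x hx => ?_⟩
    · have : Tendsto (fun x : ℝ => 1 - x) (𝓝 0) (𝓝 (1 - 0)) :=
        (continuous_const.sub continuous_id).tendsto 0
      rw [sub_zero] at this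
      exact this.mono_left nhdsWithin_le_nhds
    · exact sub_lt_self (1:ℝ) (mem_Ioi.1 hx)
  have hz1 := tendsto_nhdsGT_zero_limit_eq_zero hhr (hlim1.comp hflip) fun x hx => by
    have hx' : 1 - x ∈ Ioo (0:ℝ) 1 := ⟨sub_pos.2 hx.2, sub_lt_self 1 hx.1⟩
    refine (hle _ hx').trans ?_
    nlinarith [mul_nonneg (mul_nonneg hx.1.le hx.1.le) (hh0 _ hx')]
  rw [intervalIntegral.integral_same, add_zero] at hz0
  rwa [hz0, zero_add, intervalIntegral.integral_of_le zero_le_one,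
    integral_Ioc_eq_integral_Ioo] at hz1

open Polynomial in
/-- A continuous integrable function on `(0, 1)` all of whose even moments vanish is zero. -/
theorem eqOn_zero_of_even_moments_eq_zero {V : ℝ → ℂ} (hV : IntegrableOn V (Ioo 0 1))
    (hcont : ContinuousOn V (Ioo 0 1))
    (hmom : ∀ n : ℕ, ∫ x in Ioo (0:ℝ) 1, (x:ℂ) ^ (2 * n) * V x = 0) :
    EqOn V 0 (Ioo 0 1) := by
  have hint : ∀ φ : ℝ → ℝ, ContinuousOn φ (Icc 0 1) →
      IntegrableOn (fun x => (φ x : ℂ) * V x) (Ioo 0 1) := by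
    intro φ hφ
    obtain ⟨C, hC⟩ := isCompact_Icc.exists_bound_of_continuousOn hφ
    refine Integrable.bdd_mul (c := C) hV ?_ ?_
    · exact (Complex.continuous_ofReal.comp_continuousOn
        (hφ.mono Ioo_subset_Icc_self)).aestronglyMeasurable measurableSet_Ioo
    · filter_upwards [ae_restrict_mem measurableSet_Ioo] with x hx
      simpa using hC x (Ioo_subset_Icc_self hx)
  have hpoly : ∀ p : ℝ[X], ∫ x in Ioo (0:ℝ) 1, ((p.eval (x ^ 2) : ℝ) : ℂ) * V x = 0 := by
    intro p
    induction p using Polynomial.induction_on' with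
    | add p q hp hq =>
      have := integral_add (hint (fun x => p.eval (x ^ 2)) (by fun_prop))
        (hint (fun x => q.eval (x ^ 2)) (by fun_prop))
      rw [hp, hq, add_zero] at this
      rw [← this]
      simp only [eval_add, Complex.ofReal_add, add_mul]
    | monomial n a =>
      have : ∀ x : ℝ, (((monomial n a).eval (x ^ 2) : ℝ) : ℂ) * V x
          = (a : ℂ) * ((x:ℂ) ^ (2 * n) * V x) := fun x => by
        rw [eval_monomial]; push_cast; ring
      simp only [this]
      rw [integral_const_mul, hmom, mul_zero]
  have hzero : ∀ φ : ℝ → ℝ, Continuous φ → ∫ x in Ioo (0:ℝ) 1, (φ x : ℂ) * V x = 0 := by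
    intro φ hφ
    rw [← norm_le_zero_iff]
    refine le_of_forall_pos_le_add fun ε hε => ?_
    rw [zero_add]
    set I := ∫ x in Ioo (0:ℝ) 1, ‖V x‖
    have hI : 0 ≤ I := integral_nonneg fun _ => norm_nonneg _
    obtain ⟨p, hp⟩ := exists_polynomial_near_of_continuousOn 0 1 (fun z => φ (√z))
      (by fun_prop) (ε / (I + 1)) (by positivity)
    have hsub : ∫ x in Ioo (0:ℝ) 1, (φ x : ℂ) * V x
        = ∫ x in Ioo (0:ℝ) 1, ((φ x - p.eval (x ^ 2) : ℝ) : ℂ) * V x := by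
      have := integral_sub (hint φ hφ.continuousOn)
        (hint (fun x => p.eval (x ^ 2)) (by fun_prop))
      rw [hpoly, sub_zero] at this
      rw [← this]
      simp only [Complex.ofReal_sub, sub_mul]
    rw [hsub]
    calc _ ≤ ∫ x in Ioo (0:ℝ) 1, ε / (I + 1) * ‖V x‖ := by
          refine norm_integral_le_of_norm_le (hV.norm.const_mul _) ?_
          filter_upwards [ae_restrict_mem measurableSet_Ioo] with x hx
          rw [norm_mul, Complex.norm_real, Real.norm_eq_abs, abs_sub_comm]
          have := hp (x ^ 2) ⟨by positivity, pow_le_one₀ hx.1.le hx.2.le⟩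
          rw [Real.sqrt_sq hx.1.le] at this
          gcongr
      _ = ε / (I + 1) * I := integral_const_mul _ _
      _ ≤ ε := by
          rw [div_mul_eq_mul_div, div_le_iff₀ (by positivity)]
          nlinarith
  have hae := isOpen_Ioo.ae_eq_zero_of_integral_contDiff_smul_eq_zero (μ := volume)
    hV.locallyIntegrableOn fun g hg _ hgs => by
      rw [← hzero g hg.continuous,
        ← setIntegral_eq_integral_of_forall_compl_eq_zero (s := Ioo (0:ℝ) 1)]
      · simp only [Complex.real_smul]
      · intro x hx
        rw [image_eq_zero_of_notMem_tsupport fun hx' => hx (hgs hx'), zero_smul]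
  refine Measure.eqOn_open_of_ae_eq (μ := volume) ?_ isOpen_Ioo hcont continuousOn_const
  exact (ae_restrict_iff' measurableSet_Ioo).2 hae

/-- Integrability of the weight `(1 - x²)ˢ` on `(0, 1)` for `s > -1`. -/
theorem integrableOn_one_sub_sq_rpow {s : ℝ} (hs : -1 < s) :
    IntegrableOn (fun x : ℝ => (1 - x ^ 2) ^ s) (Ioo 0 1) := by
  have h1 : IntervalIntegrable (fun x : ℝ => (1 - x) ^ s) volume 0 1 := by
    simpa using
      ((intervalIntegral.intervalIntegrable_rpow' (a := 0) (b := 1) hs).comp_sub_left 1).symm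
  have h2 : IntervalIntegrable (fun x : ℝ => (1 - x) ^ s * (1 + x) ^ s) volume 0 1 := by
    refine h1.mul_continuousOn (ContinuousOn.rpow_const (by fun_prop) fun x hx => ?_)
    rw [uIcc_of_le zero_le_one] at hx
    exact Or.inl (by linarith [hx.1])
  refine ((intervalIntegrable_iff_integrableOn_Ioo_of_le zero_le_one).1 h2).congr_fun
    (fun x hx => ?_) measurableSet_Ioo
  simp only
  rw [← Real.mul_rpow (by linarith [hx.2]) (by linarith [hx.1])]
  ring_nf

/-- The derivative of the weight `(1 - x²)ᵃ` on `(0, 1)`. -/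
theorem hasDerivAt_one_sub_sq_cpow (a : ℂ) {x : ℝ} (hx : x ∈ Ioo (0:ℝ) 1) :
    HasDerivAt (fun y : ℝ => (1 - (y:ℂ) ^ 2) ^ a)
      (-2 * a * x * (1 - (x:ℂ) ^ 2) ^ a / (1 - (x:ℂ) ^ 2)) x := by
  have hpos : 0 < 1 - x ^ 2 := by nlinarith [hx.1, hx.2]
  have hcast : (1 - (x:ℂ) ^ 2) = ((1 - x ^ 2 : ℝ) : ℂ) := by push_cast; rfl
  have hmem : (1 - (x:ℂ) ^ 2) ∈ Complex.slitPlane := by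
    rw [hcast]; exact Complex.ofReal_mem_slitPlane.2 hpos
  have hne : (1 - (x:ℂ) ^ 2) ≠ 0 := Complex.slitPlane_ne_zero hmem
  have h1 : HasDerivAt (fun z : ℂ => 1 - z ^ 2) (-(2 * (x:ℂ))) (x:ℂ) := by
    simpa using ((hasDerivAt_id (x:ℂ)).pow 2).const_sub 1
  have h2 := (h1.cpow_const (c := a) hmem).comp_ofReal
  convert h2 using 1
  rw [Complex.cpow_sub _ _ hne, Complex.cpow_one]
  ring

/-- The spectral equation of the linearized operator has no nontrivial `H¹`
solution for `Re λ > 0`, `λ ≠ 1`: if `u ∈ C²((0,1),ℂ)` solves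
`-(1-ρ²)u'' + (-4/ρ + (2λ+5)ρ)u' + ((λ+5/2)(λ+3/2) - 35/4)u = 0` on `(0,1)` and
`∫₀¹ (|u|² + |u'|²) ρ⁴ dρ < ∞`, then `u ≡ 0`. -/
theorem spectral_equation_trivial
    (l : ℂ) (hl : 0 < l.re) (hl1 : l ≠ 1) (u u' u'' : ℝ → ℂ)
    (hu : ∀ ρ ∈ Ioo (0:ℝ) 1, HasDerivAt u (u' ρ) ρ)
    (hu' : ∀ ρ ∈ Ioo (0:ℝ) 1, HasDerivAt u' (u'' ρ) ρ)
    (hu'' : ContinuousOn u'' (Ioo (0:ℝ) 1))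
    (hode : ∀ ρ ∈ Ioo (0:ℝ) 1,
      -(1 - (ρ:ℂ)^2) * u'' ρ + (-4/(ρ:ℂ) + (2*l + 5)*(ρ:ℂ)) * u' ρ
        + ((l + 5/2) * (l + 3/2) - 35/4) * u ρ = 0)
    (hint : ∫⁻ ρ in Ioo (0:ℝ) 1, ENNReal.ofReal ((‖u ρ‖^2 + ‖u' ρ‖^2) * ρ^4) < ⊤) :
    ∀ ρ ∈ Ioo (0:ℝ) 1, u ρ = 0 := by
  have hne : ∀ ρ ∈ Ioo (0:ℝ) 1, (1 - (ρ:ℂ) ^ 2) ≠ 0 := fun ρ hρ => by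
    have : 1 - ρ ^ 2 ≠ 0 := by nlinarith [hρ.1, hρ.2]
    exact_mod_cast this
  have hcu : ContinuousOn u (Ioo 0 1) := fun x hx => (hu x hx).continuousAt.continuousWithinAt
  have hcu' : ContinuousOn u' (Ioo 0 1) := fun x hx => (hu' x hx).continuousAt.continuousWithinAt
  have hE : IntegrableOn (fun ρ => (‖u ρ‖ ^ 2 + ‖u' ρ‖ ^ 2) * ρ ^ 4) (Ioo 0 1) :=
    ⟨ContinuousOn.aestronglyMeasurable (by fun_prop) measurableSet_Ioo,
      (hasFiniteIntegral_iff_ofReal (ae_of_all _ fun ρ => by positivity)).2 hint⟩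
  set A : ℝ → ℂ := fun ρ => (1 - (ρ:ℂ) ^ 2) ^ (l - 1 / 2) with hAdef
  have hA : ∀ ρ ∈ Ioo (0:ℝ) 1, HasDerivAt A
      (-2 * (l - 1 / 2) * ρ * A ρ / (1 - (ρ:ℂ) ^ 2)) ρ :=
    fun ρ hρ => hasDerivAt_one_sub_sq_cpow _ hρ
  have hcA : ContinuousOn A (Ioo 0 1) := fun x hx => (hA x hx).continuousAt.continuousWithinAt
  have hAnorm : ∀ ρ ∈ Ioo (0:ℝ) 1, ‖A ρ‖ ^ 2 = (1 - ρ ^ 2) ^ (2 * l.re - 1) := by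
    intro ρ hρ
    have hpos : 0 < 1 - ρ ^ 2 := by nlinarith [hρ.1, hρ.2]
    have hcast : (1 - (ρ:ℂ) ^ 2) = ((1 - ρ ^ 2 : ℝ) : ℂ) := by push_cast; rfl
    simp only [hAdef]
    rw [hcast, Complex.norm_cpow_eq_rpow_re_of_pos hpos, ← Real.rpow_natCast,
      ← Real.rpow_mul hpos.le]
    congr 1
    simp
    ring
  have hB : IntegrableOn (fun ρ : ℝ => (ρ:ℂ) ^ 2 * A ρ * u ρ) (Ioo 0 1) := by
    refine Integrable.mono'
      ((integrableOn_one_sub_sq_rpow (s := 2 * l.re - 1) (by linarith)).add hE)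
      (ContinuousOn.aestronglyMeasurable (by fun_prop) measurableSet_Ioo) ?_
    filter_upwards [ae_restrict_mem measurableSet_Ioo] with ρ hρ
    simp only [Pi.add_apply, ← hAnorm ρ hρ, norm_mul, norm_pow, Complex.norm_real,
      Real.norm_of_nonneg hρ.1.le]
    nlinarith [sq_nonneg (‖A ρ‖ - ρ ^ 2 * ‖u ρ‖), sq_nonneg (ρ ^ 2 * ‖u ρ‖), sq_nonneg ‖A ρ‖,
      sq_nonneg (ρ ^ 2 * ‖u' ρ‖)]
  have hBn : ∀ n : ℕ,
      IntegrableOn (fun ρ : ℝ => (ρ:ℂ) ^ (2 * n) * ((ρ:ℂ) ^ 2 * A ρ * u ρ)) (Ioo 0 1) := by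
    intro n
    refine Integrable.bdd_mul (c := 1) hB
      (ContinuousOn.aestronglyMeasurable (by fun_prop) measurableSet_Ioo) ?_
    filter_upwards [ae_restrict_mem measurableSet_Ioo] with ρ hρ
    rw [norm_pow, Complex.norm_real, Real.norm_of_nonneg hρ.1.le]
    exact pow_le_one₀ hρ.1.le hρ.2.le
  have hrec : ∀ n : ℕ,
      (2 * n + l - 1) * (2 * n + l + 5) *
          (∫ ρ in Ioo (0:ℝ) 1, (ρ:ℂ) ^ (2 * (n + 1)) * ((ρ:ℂ) ^ 2 * A ρ * u ρ))
        - 2 * n * (2 * n + 3) *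
          (∫ ρ in Ioo (0:ℝ) 1, (ρ:ℂ) ^ (2 * n) * ((ρ:ℂ) ^ 2 * A ρ * u ρ)) = 0 := by
    intro n
    rw [← integral_const_mul, ← integral_const_mul,
      ← integral_sub ((hBn (n + 1)).const_mul _) ((hBn n).const_mul _)]
    refine integral_deriv_eq_zero_of_sq_le
      (F := fun ρ : ℝ => (ρ:ℂ) ^ (2 * n + 3) * ((1 - (ρ:ℂ) ^ 2) * A ρ) * (ρ * u' ρ - 2 * n * u ρ))
      (hE.const_mul (4 * (1 + 4 * (n:ℝ) ^ 2))) ?_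
      (((hBn (n + 1)).const_mul _).sub ((hBn n).const_mul _)) ?_
    · intro ρ hρ
      have hρ0 : (ρ:ℂ) ≠ 0 := by exact_mod_cast hρ.1.ne'
      have hid : HasDerivAt (fun y : ℝ => (y:ℂ)) 1 ρ := Complex.ofRealCLM.hasDerivAt
      have hd := ((hid.pow (2 * n + 3)).mul (((hid.pow 2).const_sub 1).mul (hA ρ hρ))).mul
        ((hid.mul (hu' ρ hρ)).sub ((hu ρ hρ).const_mul (2 * (n:ℂ))))
      have hode' : (1 - (ρ:ℂ) ^ 2) * u'' ρ = (-4/(ρ:ℂ) + (2*l + 5)*(ρ:ℂ)) * u' ρ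
        + ((l + 5/2) * (l + 3/2) - 35/4) * u ρ := by linear_combination -hode ρ hρ
      have h1 := hne ρ hρ
      have hsol : u'' ρ = ((-4/(ρ:ℂ) + (2*l + 5)*(ρ:ℂ)) * u' ρ
        + ((l + 5/2) * (l + 3/2) - 35/4) * u ρ) / (1 - (ρ:ℂ) ^ 2) := by
        rw [eq_div_iff h1]; linear_combination hode'
      refine hd.congr_deriv ?_
      simp only [Pi.mul_apply, Pi.pow_apply, Pi.sub_apply]
      rw [hsol, show 2 * n + 3 - 1 = 2 * n + 2 by omega]
      generalize A ρ = a at *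
      push_cast
      field_simp
      ring
    · intro ρ hρ
      have hA2 : (1 - ρ ^ 2) * ‖A ρ‖ ^ 2 ≤ 1 := by
        have hpos : 0 < 1 - ρ ^ 2 := by nlinarith [hρ.1, hρ.2]
        rw [hAnorm ρ hρ, ← Real.rpow_one_add' hpos.le (by linarith)]
        exact Real.rpow_le_one hpos.le (by nlinarith [hρ.1]) (by linarith)
      have hcast : ‖(1 - (ρ:ℂ) ^ 2)‖ = 1 - ρ ^ 2 := by
        rw [show (1 - (ρ:ℂ) ^ 2) = ((1 - ρ ^ 2 : ℝ) : ℂ) by push_cast; rfl, Complex.norm_real,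
          Real.norm_of_nonneg (by nlinarith [hρ.1, hρ.2])]
      have hlin : ‖(ρ:ℂ) * u' ρ - 2 * n * u ρ‖ ^ 2
          ≤ 2 * (1 + 4 * (n:ℝ) ^ 2) * (‖u ρ‖ ^ 2 + ‖u' ρ‖ ^ 2) := by
        have h1 : ‖(ρ:ℂ) * u' ρ - 2 * n * u ρ‖ ≤ ‖u' ρ‖ + 2 * n * ‖u ρ‖ := by
          refine (norm_sub_le _ _).trans ?_
          simp only [norm_mul, Complex.norm_real, Real.norm_of_nonneg hρ.1.le, Complex.norm_ofNat,
            Complex.norm_natCast]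
          nlinarith [norm_nonneg (u' ρ), hρ.2]
        calc _ ≤ (‖u' ρ‖ + 2 * n * ‖u ρ‖) ^ 2 := by gcongr
          _ ≤ _ := by nlinarith [sq_nonneg (‖u' ρ‖ - 2 * n * ‖u ρ‖), sq_nonneg (‖u ρ‖),
              sq_nonneg ((n:ℝ) * ‖u' ρ‖)]
      have hpow : (ρ ^ (2 * n + 3)) ^ 2 ≤ ρ * ρ ^ 4 := by
        rw [← pow_mul, ← pow_succ']
        exact pow_le_pow_of_le_one hρ.1.le hρ.2.le (by omega)
      simp only [norm_mul, norm_pow, hcast, Complex.norm_real, Real.norm_of_nonneg hρ.1.le]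
        at hlin ⊢
      have h3 : (1 - ρ ^ 2) ≤ 2 * (1 - ρ) := by nlinarith [sq_nonneg (1 - ρ)]
      have h4 : 0 ≤ 1 - ρ ^ 2 := by nlinarith [hρ.1, hρ.2]
      calc _ = (ρ ^ (2 * n + 3)) ^ 2 * ((1 - ρ ^ 2) * ((1 - ρ ^ 2) * ‖A ρ‖ ^ 2))
            * ‖(ρ:ℂ) * u' ρ - 2 * n * u ρ‖ ^ 2 := by ring
        _ ≤ (ρ * ρ ^ 4) * ((2 * (1 - ρ)) * 1)
            * (2 * (1 + 4 * (n:ℝ) ^ 2) * (‖u ρ‖ ^ 2 + ‖u' ρ‖ ^ 2)) := by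
          have := hρ.1
          have := hρ.2
          have : 0 ≤ 2 * (1 - ρ) := by linarith
          gcongr
        _ = _ := by ring
  have hmom : ∀ n : ℕ,
      ∫ ρ in Ioo (0:ℝ) 1, (ρ:ℂ) ^ (2 * (n + 1)) * ((ρ:ℂ) ^ 2 * A ρ * u ρ) = 0 := by
    have hc : ∀ n : ℕ, (2 * (n:ℂ) + l - 1) * (2 * n + l + 5) ≠ 0 := by
      intro n
      have hn : (0:ℝ) ≤ n := n.cast_nonneg
      refine mul_ne_zero ?_ fun h => ?_
      · rcases n with _ | n
        · simpa [sub_eq_zero] using hl1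
        · intro h
          have := congrArg Complex.re h
          simp at this
          have hn : (0:ℝ) ≤ n := n.cast_nonneg
          linarith
      · have := congrArg Complex.re h
        simp at this
        linarith
    intro n
    induction n with
    | zero =>
      have := hrec 0
      rw [Nat.cast_zero, mul_zero, zero_mul, zero_mul, sub_zero] at this
      exact (mul_eq_zero.1 this).resolve_left (by simpa using hc 0)
    | succ n ih =>
      have := hrec (n + 1)
      rw [ih, mul_zero, sub_zero] at this
      exact (mul_eq_zero.1 this).resolve_left (hc (n + 1))
  have hV := eqOn_zero_of_even_moments_eq_zero (hBn 1)
    (by fun_prop) fun n => by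
      rw [← hmom n]
      congr 1
      funext ρ
      ring
  intro ρ hρ
  have hρ0 : (ρ:ℂ) ≠ 0 := by exact_mod_cast hρ.1.ne'
  have hA0 : A ρ ≠ 0 := by simp [hAdef, Complex.cpow_eq_zero_iff, hne ρ hρ]
  simpa [hρ0, hA0] using hV hρ
end

section
/- If u ∈ C²((0,1), ℂ) satisfies −(1−ρ²) u''(ρ) + (−4/ρ + 7ρ) u'(ρ) = 0 for all ρ ∈ (0,1) and ∫₀¹ |u'(ρ)|² ρ⁴ dρ < ∞, then u is constant on (0,1). -/
open Set MeasureTheory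

theorem exists_eq_const_of_hasDerivAt_zero_Ioo {a b : ℝ} {f : ℝ → ℂ}
    (hf : ∀ x ∈ Ioo a b, HasDerivAt f 0 x) : ∃ c : ℂ, ∀ x ∈ Ioo a b, f x = c :=
  isOpen_Ioo.exists_is_const_of_deriv_eq_zero isPreconnected_Ioo
    (fun x hx => (hf x hx).differentiableAt.differentiableWithinAt)
    (fun x hx => (hf x hx).deriv)

theorem lintegral_Ioo_zero_one_ofReal_div_eq_top {K : ℝ} (hK : 0 < K) :
    ∫⁻ x in Ioo (0:ℝ) 1, ENNReal.ofReal (K / x) = ⊤ := by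
  by_contra h
  have hint : IntegrableOn (fun x : ℝ => K / x) (Ioo 0 1) := by
    refine (lintegral_ofReal_ne_top_iff_integrable ?_ ?_).mp h
    · exact (measurable_const.div measurable_id).aestronglyMeasurable
    · filter_upwards [ae_restrict_mem measurableSet_Ioo] with x hx
      exact div_nonneg hK.le hx.1.le
  have hinv : IntervalIntegrable (fun x : ℝ => x⁻¹) volume 0 1 := by
    rw [intervalIntegrable_iff_integrableOn_Ioo_of_le zero_le_one]
    refine (hint.const_mul K⁻¹).congr (ae_of_all _ fun x => ?_)
    field_simp
  simp at hinv

/-- At the eigenvalue `λ = 1`, every `C²((0,1),ℂ)` solution of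
`-(1-ρ²)u'' + (-4/ρ + 7ρ)u' = 0` with `∫₀¹ |u'|² ρ⁴ dρ < ∞` is constant. -/
theorem eigenvalue_one_geometric_simple
    (u u' u'' : ℝ → ℂ)
    (hu : ∀ ρ ∈ Ioo (0:ℝ) 1, HasDerivAt u (u' ρ) ρ)
    (hu' : ∀ ρ ∈ Ioo (0:ℝ) 1, HasDerivAt u' (u'' ρ) ρ)
    (hu'' : ContinuousOn u'' (Ioo (0:ℝ) 1))
    (hode : ∀ ρ ∈ Ioo (0:ℝ) 1,
      -(1 - (ρ:ℂ)^2) * u'' ρ + (-4/(ρ:ℂ) + 7*(ρ:ℂ)) * u' ρ = 0)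
    (hint : ∫⁻ ρ in Ioo (0:ℝ) 1, ENNReal.ofReal (‖u' ρ‖^2 * ρ^4) < ⊤) :
    ∃ c : ℂ, ∀ ρ ∈ Ioo (0:ℝ) 1, u ρ = c := by
  -- The square of `ρ⁴ (1 - ρ²)^(3/2) u'` is a first integral.
  obtain ⟨k, hk⟩ : ∃ k : ℂ, ∀ ρ ∈ Ioo (0:ℝ) 1,
      (ρ:ℂ)^8 * (1 - (ρ:ℂ)^2)^3 * u' ρ ^ 2 = k := by
    refine exists_eq_const_of_hasDerivAt_zero_Ioo fun ρ hρ => ?_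
    have hρ0 : (ρ:ℂ) ≠ 0 := by exact_mod_cast hρ.1.ne'
    have hid : HasDerivAt (fun x : ℝ => (x:ℂ)) 1 ρ := Complex.ofRealCLM.hasDerivAt
    have hd := ((hid.pow 8).mul (((hid.pow 2).const_sub 1).pow 3)).mul ((hu' ρ hρ).pow 2)
    have ho : (ρ:ℂ) * (1 - (ρ:ℂ)^2) * u'' ρ = (-4 + 7 * (ρ:ℂ)^2) * u' ρ := by
      have h := hode ρ hρ
      field_simp at h
      linear_combination -h
    refine hd.congr_deriv ?_
    simp
    linear_combination 2 * (ρ:ℂ)^7 * (1 - (ρ:ℂ)^2)^2 * u' ρ * ho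
  have hk0 : k = 0 := by
    by_contra hne
    refine hint.ne (top_le_iff.mp ?_)
    rw [← lintegral_Ioo_zero_one_ofReal_div_eq_top (norm_pos_iff.mpr hne)]
    refine setLIntegral_mono' measurableSet_Ioo fun ρ hρ => ENNReal.ofReal_le_ofReal ?_
    obtain ⟨h0, h1⟩ := hρ
    have hsq : 0 ≤ 1 - ρ^2 := by nlinarith
    have hnorm : ‖k‖ = ρ^8 * (1 - ρ^2)^3 * ‖u' ρ‖^2 := by
      have hw : ‖(1 - (ρ:ℂ)^2)‖ = 1 - ρ^2 := by
        rw [show (1 - (ρ:ℂ)^2) = ((1 - ρ^2 : ℝ) : ℂ) by push_cast; ring,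
          Complex.norm_of_nonneg hsq]
      rw [← hk ρ ⟨h0, h1⟩, norm_mul, norm_mul, norm_pow, norm_pow, norm_pow, hw,
        Complex.norm_of_nonneg h0.le]
    have h3 : ρ^3 * (1 - ρ^2)^3 ≤ 1 :=
      mul_le_one₀ (pow_le_one₀ h0.le h1.le) (pow_nonneg hsq 3)
        (pow_le_one₀ hsq (by nlinarith))
    rw [hnorm, div_le_iff₀ h0]
    calc ρ^8 * (1 - ρ^2)^3 * ‖u' ρ‖^2
        = (ρ^3 * (1 - ρ^2)^3) * (‖u' ρ‖^2 * ρ^4 * ρ) := by ring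
      _ ≤ 1 * (‖u' ρ‖^2 * ρ^4 * ρ) := by gcongr
      _ = ‖u' ρ‖^2 * ρ^4 * ρ := one_mul _
  refine exists_eq_const_of_hasDerivAt_zero_Ioo fun ρ hρ => ?_
  have hρ0 : (ρ:ℂ) ≠ 0 := by exact_mod_cast hρ.1.ne'
  have hw0 : (1 - (ρ:ℂ)^2) ≠ 0 := by
    have h : 1 - ρ^2 ≠ 0 := by nlinarith [hρ.1, hρ.2]
    exact_mod_cast h
  have h := hk ρ hρ
  rw [hk0] at h
  have hz : u' ρ = 0 := by simpa [hρ0, hw0] using h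
  simpa [hz] using hu ρ hρ
end

section
/- Every u ∈ C²((0,1), ℂ) satisfying −(1−ρ²) u''(ρ) + (−4/ρ + 7ρ) u'(ρ) = 12 for all ρ ∈ (0,1) has ∫₀¹ |u'(ρ)|² ρ⁴ dρ = ∞. In other words, the inhomogeneous equation (1 − L̃)u = g with right-hand side the eigenfunction has no solution of finite radial H¹(𝔹⁵) energy. -/
open Set MeasureTheory

/-- A function dominating a positive multiple of `|x - c|⁻¹` on an interval whose closure
contains `c` has infinite integral over any larger set. -/
theorem lintegral_ofReal_eq_top_of_inv_abs_le {a b c k : ℝ} {f : ℝ → ℝ} {s : Set ℝ}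
    (hab : a < b) (hc : c ∈ Icc a b) (hk : 0 < k) (hs : Ioo a b ⊆ s)
    (hf : ∀ x ∈ Ioo a b, k * |(x - c)⁻¹| ≤ f x) :
    ∫⁻ x in s, ENNReal.ofReal (f x) = ⊤ := by
  by_contra h
  have hle : ∫⁻ x in Ioo a b, ENNReal.ofReal |k * (x - c)⁻¹| < ⊤ :=
    calc ∫⁻ x in Ioo a b, ENNReal.ofReal |k * (x - c)⁻¹|
        ≤ ∫⁻ x in Ioo a b, ENNReal.ofReal (f x) :=
          setLIntegral_mono' measurableSet_Ioo fun x hx =>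
            ENNReal.ofReal_le_ofReal (by rw [abs_mul, abs_of_pos hk]; exact hf x hx)
      _ ≤ ∫⁻ x in s, ENNReal.ofReal (f x) := lintegral_mono_set hs
      _ < ⊤ := lt_top_iff_ne_top.2 h
  have hint : IntegrableOn (fun x => k * (x - c)⁻¹) (Ioo a b) := by
    refine ⟨by fun_prop, ?_⟩
    rw [hasFiniteIntegral_iff_norm]
    simpa only [Real.norm_eq_abs] using hle
  have hint' : IntervalIntegrable (fun x => (x - c)⁻¹) volume a b := by
    rw [intervalIntegrable_iff_integrableOn_Ioo_of_le hab.le]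
    simpa [hk.ne', IntegrableOn] using hint.const_mul k⁻¹
  rw [intervalIntegrable_sub_inv_iff, uIcc_of_le hab.le] at hint'
  exact hint'.elim hab.ne (· hc)

/-- Nonexistence of a generalized eigenfunction at `λ = 1`: every
`u ∈ C²((0,1),ℂ)` solving `-(1-ρ²)u'' + (-4/ρ + 7ρ)u' = 12` on `(0,1)` has
infinite radial `H¹(𝔹⁵)` energy, `∫₀¹ |u'|² ρ⁴ dρ = ∞`. -/
theorem eigenvalue_one_algebraically_simple
    (u u' u'' : ℝ → ℂ)
    (hu : ∀ ρ ∈ Ioo (0:ℝ) 1, HasDerivAt u (u' ρ) ρ)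
    (hu' : ∀ ρ ∈ Ioo (0:ℝ) 1, HasDerivAt u' (u'' ρ) ρ)
    (hu'' : ContinuousOn u'' (Ioo (0:ℝ) 1))
    (hode : ∀ ρ ∈ Ioo (0:ℝ) 1,
      -(1 - (ρ:ℂ)^2) * u'' ρ + (-4/(ρ:ℂ) + 7*(ρ:ℂ)) * u' ρ = 12) :
    ∫⁻ ρ in Ioo (0:ℝ) 1, ENNReal.ofReal (‖u' ρ‖^2 * ρ^4) = ⊤ := by
  -- `w` is the real part of `u'` divided by the homogeneous solution `ρ⁻⁴ (1 - ρ²)^(-3/2)`.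
  let w : ℝ → ℝ := fun ρ => ρ ^ 4 * √(1 - ρ ^ 2) ^ 3 * (u' ρ).re
  have hode_re : ∀ ρ ∈ Ioo (0:ℝ) 1,
      -(1 - ρ ^ 2) * (u'' ρ).re + (-4 / ρ + 7 * ρ) * (u' ρ).re = 12 := by
    intro ρ hρ
    have h := hode ρ hρ
    rw [show -(1 - (ρ:ℂ) ^ 2) = ((-(1 - ρ ^ 2) : ℝ) : ℂ) by push_cast; ring,
      show -4 / (ρ:ℂ) + 7 * (ρ:ℂ) = ((-4 / ρ + 7 * ρ : ℝ) : ℂ) by push_cast; ring] at h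
    simpa only [Complex.add_re, Complex.re_ofReal_mul, Complex.re_ofNat] using
      congrArg Complex.re h
  have hw : ∀ ρ ∈ Ioo (0:ℝ) 1, HasDerivAt w (-12 * ρ ^ 4 * √(1 - ρ ^ 2)) ρ := by
    intro ρ hρ
    have hpos : 0 < 1 - ρ ^ 2 := by nlinarith [hρ.1, hρ.2]
    have hre : HasDerivAt (fun ρ => (u' ρ).re) (u'' ρ).re ρ :=
      (Complex.reCLM.hasFDerivAt (x := u' ρ)).comp_hasDerivAt ρ (hu' ρ hρ)
    have hsqrt := (((hasDerivAt_id ρ).fun_pow 2).const_sub 1).sqrt hpos.ne'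
    refine ((((hasDerivAt_id ρ).fun_pow 4).fun_mul (hsqrt.fun_pow 3)).fun_mul hre).congr_deriv ?_
    have hs : 0 < √(1 - ρ ^ 2) := Real.sqrt_pos.2 hpos
    have hs2 : √(1 - ρ ^ 2) ^ 2 = 1 - ρ ^ 2 := Real.sq_sqrt hpos.le
    have h := hode_re ρ hρ
    have h0 : ρ ≠ 0 := hρ.1.ne'
    simp only [id]
    generalize √(1 - ρ ^ 2) = s at *
    rw [← hs2] at h
    field_simp at h ⊢
    linear_combination (-2 * s ^ 2) * ρ ^ 3 * h + 8 * ρ ^ 3 * s ^ 2 * (u' ρ).re * hs2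
  have hanti : StrictAntiOn w (Ioo 0 1) := by
    refine strictAntiOn_of_deriv_neg (convex_Ioo 0 1)
      (fun ρ hρ => (hw ρ hρ).continuousAt.continuousWithinAt) fun ρ hρ => ?_
    rw [interior_Ioo] at hρ
    rw [(hw ρ hρ).deriv]
    have hs : 0 < √(1 - ρ ^ 2) := Real.sqrt_pos.2 (by nlinarith [hρ.1, hρ.2])
    have := mul_pos (pow_pos hρ.1 4) hs
    linarith
  have hbound : ∀ ρ ∈ Ioo (0:ℝ) 1,
      w ρ ^ 2 ≤ ‖u' ρ‖ ^ 2 * ρ ^ 4 * (ρ ^ 4 * (1 - ρ ^ 2) ^ 3) := by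
    intro ρ hρ
    have hpos : 0 < 1 - ρ ^ 2 := by nlinarith [hρ.1, hρ.2]
    have hre : (u' ρ).re ^ 2 ≤ ‖u' ρ‖ ^ 2 := sq_le_sq.2 (by
      simpa using Complex.abs_re_le_norm (u' ρ))
    calc w ρ ^ 2 = (u' ρ).re ^ 2 * (ρ ^ 8 * (√(1 - ρ ^ 2) ^ 2) ^ 3) := by ring
      _ = (u' ρ).re ^ 2 * (ρ ^ 8 * (1 - ρ ^ 2) ^ 3) := by rw [Real.sq_sqrt hpos.le]
      _ ≤ ‖u' ρ‖ ^ 2 * (ρ ^ 8 * (1 - ρ ^ 2) ^ 3) := by gcongr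
      _ = _ := by ring
  rcases le_or_gt 0 (w (1 / 2)) with h | h
  · have hc : 0 < w (1 / 4) :=
      h.trans_lt (hanti (by norm_num) (by norm_num) (by norm_num))
    refine lintegral_ofReal_eq_top_of_inv_abs_le (a := 0) (b := 1 / 4) (c := 0)
      (by norm_num) (by norm_num) (pow_pos hc 2) (Ioo_subset_Ioo_right (by norm_num)) ?_
    intro ρ hρ
    have hρ' : ρ ∈ Ioo (0:ℝ) 1 := ⟨hρ.1, by linarith [hρ.2]⟩
    have hle : w (1 / 4) ≤ w ρ := (hanti hρ' (by norm_num) hρ.2).le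
    have hpos : 0 < 1 - ρ ^ 2 := by nlinarith [hρ'.1, hρ'.2]
    have hweight : ρ ^ 4 * (1 - ρ ^ 2) ^ 3 ≤ ρ :=
      calc ρ ^ 4 * (1 - ρ ^ 2) ^ 3 ≤ ρ * 1 := by
            refine mul_le_mul (pow_le_of_le_one hρ'.1.le hρ'.2.le (by norm_num)) ?_
              (by positivity) hρ'.1.le
            exact pow_le_one₀ hpos.le (by nlinarith [hρ'.1])
        _ = ρ := mul_one ρ
    rw [sub_zero, abs_of_pos (inv_pos.2 hρ.1), ← div_eq_mul_inv, div_le_iff₀ hρ.1]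
    calc w (1 / 4) ^ 2 ≤ w ρ ^ 2 := by gcongr
      _ ≤ _ := hbound ρ hρ'
      _ ≤ _ := by gcongr
  · refine lintegral_ofReal_eq_top_of_inv_abs_le (a := 1 / 2) (b := 1) (c := 1)
      (k := w (1 / 2) ^ 2 / 2) (by norm_num) (by norm_num)
      (half_pos (sq_pos_of_neg h)) (Ioo_subset_Ioo_left (by norm_num)) ?_
    intro ρ hρ
    have hρ' : ρ ∈ Ioo (0:ℝ) 1 := ⟨by linarith [hρ.1], hρ.2⟩
    have hle : w ρ ≤ w (1 / 2) := (hanti (by norm_num) hρ' hρ.1).le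
    have hpos : 0 < 1 - ρ ^ 2 := by nlinarith [hρ'.1, hρ'.2]
    have hweight : ρ ^ 4 * (1 - ρ ^ 2) ^ 3 ≤ 2 * (1 - ρ) :=
      calc ρ ^ 4 * (1 - ρ ^ 2) ^ 3 ≤ 1 * (1 - ρ ^ 2) := by
            gcongr
            · exact pow_le_one₀ hρ'.1.le hρ'.2.le
            · exact pow_le_of_le_one hpos.le (by nlinarith [hρ'.1]) (by norm_num)
        _ ≤ 2 * (1 - ρ) := by nlinarith [hρ'.1, hρ'.2]
    have hsub : 0 < 1 - ρ := sub_pos.2 hρ.2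
    rw [abs_inv, abs_sub_comm, abs_of_pos hsub, ← div_eq_mul_inv, div_le_iff₀ hsub,
      div_le_iff₀ two_pos]
    calc w (1 / 2) ^ 2 ≤ w ρ ^ 2 := by nlinarith
      _ ≤ _ := hbound ρ hρ'
      _ ≤ ‖u' ρ‖ ^ 2 * ρ ^ 4 * (2 * (1 - ρ)) := by gcongr
      _ = _ := by ring
end

section
/- Let λ ∈ ℂ. Define on (0,1): ψ₁(ρ) = ρ^{-1} (1−ρ)^{1/4 + λ/2} (1+ρ)^{3/4 − λ/2} (2 + ρ(−1+2λ)) and ψ̃₁(ρ) = ρ^{-1} (1+ρ)^{1/4 + λ/2} (1−ρ)^{3/4 − λ/2} (2 + ρ(1−2λ)), where complex powers of positive real numbers are taken with the principal branch. Then both ψ₁ and ψ̃₁ satisfy the second-order ODE v''(ρ) + ((−2 + (ρ²/4)(11 + 4λ − 4λ²)) / (ρ² (1−ρ²)²)) v(ρ) = 0 for all ρ ∈ (0,1), and their Wronskian is constant: ψ₁(ρ) ψ̃₁'(ρ) − ψ₁'(ρ) ψ̃₁(ρ) = (3−2λ)(1+2λ)(−1+2λ) for all ρ ∈ (0,1).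 -/
open Set

/-- `ψ₁(ρ;λ) = ρ⁻¹ (1-ρ)^{1/4+λ/2} (1+ρ)^{3/4-λ/2} (2+ρ(-1+2λ))`. -/
noncomputable def psiOne (l : ℂ) (ρ : ℝ) : ℂ :=
  (ρ:ℂ)⁻¹ * ((1 - ρ : ℝ) : ℂ) ^ ((1:ℂ)/4 + l/2) * ((1 + ρ : ℝ) : ℂ) ^ ((3:ℂ)/4 - l/2)
    * (2 + (ρ:ℂ) * (-1 + 2*l))

/-- `ψ̃₁(ρ;λ) = ρ⁻¹ (1+ρ)^{1/4+λ/2} (1-ρ)^{3/4-λ/2} (2+ρ(1-2λ))`. -/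
noncomputable def psiOneTilde (l : ℂ) (ρ : ℝ) : ℂ :=
  (ρ:ℂ)⁻¹ * ((1 + ρ : ℝ) : ℂ) ^ ((1:ℂ)/4 + l/2) * ((1 - ρ : ℝ) : ℂ) ^ ((3:ℂ)/4 - l/2)
    * (2 + (ρ:ℂ) * (1 - 2*l))

/-- The weight `(1-x)^(1/4+l/2) (1+x)^(3/4-l/2)` has logarithmic derivative
`-(x + l - 1/2)/(1 - x²)`. -/
theorem hasDerivAt_weight_mul (l : ℂ) {x : ℝ} (hx : x ∈ Ioo (0:ℝ) 1) {R : ℝ → ℂ} {R' : ℂ}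
    (hR : HasDerivAt R R' x) :
    HasDerivAt (fun y : ℝ => ((1 - y : ℝ) : ℂ) ^ ((1:ℂ)/4 + l/2)
        * ((1 + y : ℝ) : ℂ) ^ ((3:ℂ)/4 - l/2) * R y)
      (((1 - x : ℝ) : ℂ) ^ ((1:ℂ)/4 + l/2) * ((1 + x : ℝ) : ℂ) ^ ((3:ℂ)/4 - l/2)
        * (R' - (x + l - 1/2) / (1 - (x:ℂ)^2) * R x)) x := by
  obtain ⟨h0, h1⟩ := hx
  have hm : (0:ℝ) < 1 - x := by linarith
  have hp : (0:ℝ) < 1 + x := by linarith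
  have hm' : (1 - (x:ℂ)) ≠ 0 := by exact_mod_cast hm.ne'
  have hp' : (1 + (x:ℂ)) ≠ 0 := by exact_mod_cast hp.ne'
  have hbm : HasDerivAt (fun y : ℝ => ((1 - y : ℝ) : ℂ)) (-1) x := by
    simpa using ((hasDerivAt_id x).const_sub 1).ofReal_comp
  have hbp : HasDerivAt (fun y : ℝ => ((1 + y : ℝ) : ℂ)) 1 x := by
    simpa using ((hasDerivAt_id x).const_add 1).ofReal_comp
  have hP := ((Complex.hasStrictDerivAt_cpow_const (c := (1:ℂ)/4 + l/2)
    (Complex.ofReal_mem_slitPlane.2 hm)).hasDerivAt).comp x hbm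
  have hQ := ((Complex.hasStrictDerivAt_cpow_const (c := (3:ℂ)/4 - l/2)
    (Complex.ofReal_mem_slitPlane.2 hp)).hasDerivAt).comp x hbp
  refine ((hP.mul hQ).mul hR).congr_deriv ?_
  have hmc : ((1 - x : ℝ) : ℂ) ≠ 0 := by exact_mod_cast hm.ne'
  have hpc : ((1 + x : ℝ) : ℂ) ≠ 0 := by exact_mod_cast hp.ne'
  simp only [Function.comp_apply, Pi.mul_apply]
  rw [Complex.cpow_sub _ 1 hmc, Complex.cpow_sub _ 1 hpc, Complex.cpow_one, Complex.cpow_one,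
    show (1 - (x:ℂ)^2) = (1 - x) * (1 + x) by ring]
  generalize ((1 - x : ℝ) : ℂ) ^ ((1:ℂ)/4 + l/2) = P
  generalize ((1 + x : ℝ) : ℂ) ^ ((3:ℂ)/4 - l/2) = Q
  push_cast
  field_simp
  ring

theorem psiOne_eq (l : ℂ) : psiOne l = fun y : ℝ => ((1 - y : ℝ) : ℂ) ^ ((1:ℂ)/4 + l/2)
    * ((1 + y : ℝ) : ℂ) ^ ((3:ℂ)/4 - l/2) * ((y:ℂ)⁻¹ * (2 + (y:ℂ) * (-1 + 2*l))) := by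
  funext y
  unfold psiOne
  ring

theorem psiOneTilde_eq_psiOne (l : ℂ) : psiOneTilde l = psiOne (1 - l) := by
  funext y
  unfold psiOneTilde psiOne
  rw [show (1:ℂ)/4 + (1 - l)/2 = 3/4 - l/2 by ring, show (3:ℂ)/4 - (1 - l)/2 = 1/4 + l/2 by ring]
  ring

theorem ofReal_ne_zero_and_one_sub_sq_ne_zero {x : ℝ} (hx : x ∈ Ioo (0:ℝ) 1) :
    (x:ℂ) ≠ 0 ∧ (1 - (x:ℂ)^2) ≠ 0 := by
  refine ⟨by exact_mod_cast hx.1.ne', ?_⟩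
  have : (1 - x^2 : ℝ) ≠ 0 := by nlinarith [hx.1, hx.2]
  exact_mod_cast this

theorem hasDerivAt_psiOne (l : ℂ) {x : ℝ} (hx : x ∈ Ioo (0:ℝ) 1) :
    HasDerivAt (psiOne l) (((1 - x : ℝ) : ℂ) ^ ((1:ℂ)/4 + l/2)
      * ((1 + x : ℝ) : ℂ) ^ ((3:ℂ)/4 - l/2)
      * (-2 / (x:ℂ)^2 - (x + l - 1/2) / (1 - (x:ℂ)^2) * ((x:ℂ)⁻¹ * (2 + x * (-1 + 2*l))))) x := by
  have hx0 := (ofReal_ne_zero_and_one_sub_sq_ne_zero hx).1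
  rw [psiOne_eq]
  refine hasDerivAt_weight_mul l hx ?_
  have hid : HasDerivAt (fun y : ℝ => (y:ℂ)) 1 x := (hasDerivAt_id x).ofReal_comp
  refine ((hid.inv hx0).mul ((hid.mul_const (-1 + 2*l)).const_add 2)).congr_deriv ?_
  simp only [Pi.inv_apply]
  field_simp
  ring

theorem deriv_deriv_psiOne (l : ℂ) {x : ℝ} (hx : x ∈ Ioo (0:ℝ) 1) :
    deriv (deriv (psiOne l)) x
      + ((-2 + (x:ℂ)^2/4 * (11 + 4*l - 4*l^2)) / ((x:ℂ)^2 * (1 - (x:ℂ)^2)^2)) * psiOne l x = 0 := by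
  obtain ⟨hx0, hsq⟩ := ofReal_ne_zero_and_one_sub_sq_ne_zero hx
  have hev := Filter.eventuallyEq_of_mem (isOpen_Ioo.mem_nhds hx)
    fun y hy => (hasDerivAt_psiOne l hy).deriv
  have hid : HasDerivAt (fun y : ℝ => (y:ℂ)) 1 x := (hasDerivAt_id x).ofReal_comp
  have hR := ((hid.pow 2).inv (pow_ne_zero 2 hx0)).const_mul (-2) |>.sub
    ((((hid.add_const l).sub_const (1/2)).div ((hid.pow 2).const_sub 1) hsq).mul
      ((hid.inv hx0).mul ((hid.mul_const (-1 + 2*l)).const_add 2)))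
  rw [hev.deriv_eq]
  have h := (hasDerivAt_weight_mul l hx hR).deriv
  simp only [Pi.sub_apply, Pi.mul_apply, Pi.div_apply, Pi.inv_apply, Pi.pow_apply,
    ← div_eq_mul_inv] at h
  rw [h, psiOne_eq]
  dsimp only
  generalize ((1 - x : ℝ) : ℂ) ^ ((1:ℂ)/4 + l/2) = P
  generalize ((1 + x : ℝ) : ℂ) ^ ((3:ℂ)/4 - l/2) = Q
  push_cast
  field_simp
  ring

theorem psiOne_wronskian (l : ℂ) {x : ℝ} (hx : x ∈ Ioo (0:ℝ) 1) :
    psiOne l x * deriv (psiOne (1 - l)) x - deriv (psiOne l) x * psiOne (1 - l) x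
      = (3 - 2*l) * (1 + 2*l) * (-1 + 2*l) := by
  obtain ⟨hx0, hsq⟩ := ofReal_ne_zero_and_one_sub_sq_ne_zero hx
  have hmc : ((1 - x : ℝ) : ℂ) ≠ 0 := by exact_mod_cast (sub_pos.2 hx.2).ne'
  have hpc : ((1 + x : ℝ) : ℂ) ≠ 0 := by exact_mod_cast (add_pos one_pos hx.1).ne'
  have hP : ((1 - x : ℝ) : ℂ) ^ ((1:ℂ)/4 + l/2) * ((1 - x : ℝ) : ℂ) ^ ((3:ℂ)/4 - l/2)
      = 1 - x := by
    rw [← Complex.cpow_add _ _ hmc, show (1:ℂ)/4 + l/2 + (3/4 - l/2) = 1 by ring,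
      Complex.cpow_one]
    push_cast
    rfl
  have hQ : ((1 + x : ℝ) : ℂ) ^ ((1:ℂ)/4 + l/2) * ((1 + x : ℝ) : ℂ) ^ ((3:ℂ)/4 - l/2)
      = 1 + x := by
    rw [← Complex.cpow_add _ _ hpc, show (1:ℂ)/4 + l/2 + (3/4 - l/2) = 1 by ring,
      Complex.cpow_one]
    push_cast
    rfl
  rw [(hasDerivAt_psiOne l hx).deriv, (hasDerivAt_psiOne (1 - l) hx).deriv, psiOne_eq, psiOne_eq,
    show (1:ℂ)/4 + (1 - l)/2 = 3/4 - l/2 by ring, show (3:ℂ)/4 - (1 - l)/2 = 1/4 + l/2 by ring]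
  dsimp only
  generalize ((1 - x : ℝ) : ℂ) ^ ((1:ℂ)/4 + l/2) = P at *
  generalize ((1 + x : ℝ) : ℂ) ^ ((3:ℂ)/4 - l/2) = Q at *
  generalize ((1 - x : ℝ) : ℂ) ^ ((3:ℂ)/4 - l/2) = P₂ at *
  generalize ((1 + x : ℝ) : ℂ) ^ ((1:ℂ)/4 + l/2) = Q₂ at *
  have hprod : P * P₂ * (Q₂ * Q) = 1 - (x:ℂ)^2 := by rw [hP, hQ]; ring
  trans P * P₂ * (Q₂ * Q) * ((3 - 2*l) * (1 + 2*l) * (-1 + 2*l)) / (1 - (x:ℂ)^2)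
  · field_simp
    ring
  · rw [hprod]
    field_simp

/-- Both `ψ₁` and `ψ̃₁` solve the normal-form spectral ODE
`v'' + ((-2 + (ρ²/4)(11+4λ-4λ²))/(ρ²(1-ρ²)²)) v = 0` on `(0,1)`, and their
Wronskian is the constant `(3-2λ)(1+2λ)(-1+2λ)`. -/
theorem psiOne_solutions_and_wronskian (l : ℂ) :
    (∀ ρ ∈ Ioo (0:ℝ) 1,
      deriv (deriv (psiOne l)) ρ
        + ((-2 + (ρ:ℂ)^2/4 * (11 + 4*l - 4*l^2)) / ((ρ:ℂ)^2 * (1 - (ρ:ℂ)^2)^2))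
          * psiOne l ρ = 0) ∧
    (∀ ρ ∈ Ioo (0:ℝ) 1,
      deriv (deriv (psiOneTilde l)) ρ
        + ((-2 + (ρ:ℂ)^2/4 * (11 + 4*l - 4*l^2)) / ((ρ:ℂ)^2 * (1 - (ρ:ℂ)^2)^2))
          * psiOneTilde l ρ = 0) ∧
    (∀ ρ ∈ Ioo (0:ℝ) 1,
      psiOne l ρ * deriv (psiOneTilde l) ρ - deriv (psiOne l) ρ * psiOneTilde l ρ
        = (3 - 2*l) * (1 + 2*l) * (-1 + 2*l)) := by
  rw [psiOneTilde_eq_psiOne]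
  refine ⟨fun ρ hρ => deriv_deriv_psiOne l hρ, fun ρ hρ => ?_, fun ρ hρ => psiOne_wronskian l hρ⟩
  rw [show 11 + 4*l - 4*l^2 = 11 + 4*(1 - l) - 4*(1 - l)^2 by ring]
  exact deriv_deriv_psiOne (1 - l) hρ
end

section
/- For every λ ∈ ℂ and every ρ ∈ (0,1): ρ^{-3} (1+ρ)^{1/2 − λ} (2 + ρ(−1+2λ)) − ρ^{-3} (1−ρ)^{1/2 − λ} (2 + ρ(1−2λ)) = −((3−2λ)(−1+2λ)(1+2λ)/4) ∫_{−1}^{1} ∫₀^{1} (1 + ρ t₁ t₂)^{−3/2 − λ} t₁² dt₂ dt₁, where complex powers of positive real numbers are taken with the principal branch. -/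
open Set

theorem hasDerivAt_one_add_mul_cpow (b : ℂ) (c x : ℝ) (h : 0 < 1 + c * x) :
    HasDerivAt (fun y : ℝ => ((1 + c * y : ℝ) : ℂ) ^ b)
      (b * ((1 + c * x : ℝ) : ℂ) ^ (b - 1) * c) x := by
  have hd : HasDerivAt (fun z : ℂ => 1 + (c : ℂ) * z) (c : ℂ) (x : ℂ) := by
    simpa using ((hasDerivAt_id (x : ℂ)).const_mul (c : ℂ)).const_add 1
  have hs : 1 + (c : ℂ) * x ∈ Complex.slitPlane := by
    have := Complex.ofReal_mem_slitPlane.2 h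
    simpa using this
  simpa using (hd.cpow_const (c := b) hs).comp_ofReal

theorem continuousOn_one_add_mul_cpow (b : ℂ) (c : ℝ) (s : Set ℝ)
    (h : ∀ x ∈ s, 0 < 1 + c * x) :
    ContinuousOn (fun y : ℝ => ((1 + c * y : ℝ) : ℂ) ^ b) s := fun x hx =>
  (hasDerivAt_one_add_mul_cpow b c x (h x hx)).continuousAt.continuousWithinAt

theorem one_add_mul_pos {ρ t : ℝ} (hρ : ρ ∈ Ioo (0:ℝ) 1) (ht : -1 ≤ t) : 0 < 1 + ρ * t := by
  nlinarith [hρ.1, hρ.2]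

theorem integral_one_add_mul_cpow_mul_sq (a : ℂ) {ρ t : ℝ} (hρ : ρ ∈ Ioo (0:ℝ) 1)
    (ht : -1 ≤ t) :
    (a + 1) * ∫ s in (0:ℝ)..1, ((1 + ρ * t * s : ℝ) : ℂ) ^ a * (t:ℂ)^2
      = (t / ρ) * (((1 + ρ * t : ℝ) : ℂ) ^ (a + 1) - 1) := by
  have hρ0 : (ρ : ℂ) ≠ 0 := by exact_mod_cast hρ.1.ne'
  have hpos : ∀ s ∈ uIcc (0:ℝ) 1, 0 < 1 + ρ * t * s := by
    intro s hs
    rw [uIcc_of_le zero_le_one] at hs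
    rw [mul_assoc]
    exact one_add_mul_pos hρ (by nlinarith [hs.1, hs.2])
  rw [← intervalIntegral.integral_const_mul,
    intervalIntegral.integral_eq_sub_of_hasDerivAt
      (f := fun s : ℝ => (t / ρ : ℂ) * ((1 + ρ * t * s : ℝ) : ℂ) ^ (a + 1))]
  · simp
    ring
  · intro s hs
    refine ((hasDerivAt_one_add_mul_cpow (a + 1) (ρ * t) s (hpos s hs)).const_mul
      (t / ρ : ℂ)).congr_deriv ?_
    rw [add_sub_cancel_right, Complex.ofReal_mul]
    field_simp
  · exact (((continuousOn_one_add_mul_cpow a (ρ * t) _ hpos).mul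
      continuousOn_const).const_mul _).intervalIntegrable

theorem integral_mul_one_add_mul_cpow_sub_one (a : ℂ) {ρ : ℝ} (hρ : ρ ∈ Ioo (0:ℝ) 1) :
    (a + 2) * (a + 3) * ∫ t in (-1:ℝ)..1, (t / ρ : ℂ) * (((1 + ρ * t : ℝ) : ℂ) ^ (a + 1) - 1)
      = ((ρ:ℂ)^3)⁻¹ * (((1 + ρ : ℝ) : ℂ) ^ (a + 2) * ((a + 3) * ρ - (1 + ρ))
        + ((1 - ρ : ℝ) : ℂ) ^ (a + 2) * ((a + 3) * ρ + (1 - ρ))) := by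
  have hρ0 : (ρ : ℂ) ≠ 0 := by exact_mod_cast hρ.1.ne'
  have hpos : ∀ t ∈ uIcc (-1:ℝ) 1, 0 < 1 + ρ * t := by
    intro t ht
    rw [uIcc_of_le (by norm_num)] at ht
    exact one_add_mul_pos hρ ht.1
  have hsucc : ∀ x : ℝ, 0 < x → (x : ℂ) ^ (a + 3) = (x : ℂ) ^ (a + 2) * x := by
    intro x hx
    rw [show a + 3 = a + 2 + 1 by ring, Complex.cpow_add _ _ (by exact_mod_cast hx.ne'),
      Complex.cpow_one]
  rw [← intervalIntegral.integral_const_mul,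
    intervalIntegral.integral_eq_sub_of_hasDerivAt
      (f := fun t : ℝ => (a + 3) / (ρ:ℂ)^2 * ((t:ℂ) * ((1 + ρ * t : ℝ) : ℂ) ^ (a + 2))
        - ((ρ:ℂ)^3)⁻¹ * ((1 + ρ * t : ℝ) : ℂ) ^ (a + 3)
        - (a + 2) * (a + 3) / (2 * ρ) * (t:ℂ)^2)]
  · have h1 : 0 < 1 + ρ * 1 := hpos 1 (by simp)
    have h2 : 0 < 1 + ρ * (-1) := hpos (-1) (by simp)
    simp only [hsucc _ h1, hsucc _ h2]
    rw [mul_one, show 1 + ρ * (-1) = 1 - ρ by ring]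
    push_cast
    field_simp
    ring
  · intro t ht
    have hid : HasDerivAt (fun y : ℝ => (y : ℂ)) 1 t := (hasDerivAt_id (t : ℂ)).comp_ofReal
    refine ((((hid.mul (hasDerivAt_one_add_mul_cpow (a + 2) ρ t (hpos t ht))).const_mul _).sub
      ((hasDerivAt_one_add_mul_cpow (a + 3) ρ t (hpos t ht)).const_mul _)).sub
      ((hid.pow 2).const_mul _)).congr_deriv ?_
    rw [show a + 3 - 1 = a + 2 by ring, show a + 2 - 1 = a + 1 by ring]
    field_simp
    push_cast
    ring
  · exact ((((Complex.continuous_ofReal.div_const _).continuousOn).mul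
      ((continuousOn_one_add_mul_cpow (a + 1) ρ _ hpos).sub
        continuousOn_const)).const_mul _).intervalIntegrable

/-- Double-integral representation of `φ₀(ρ;λ) = φ₁(ρ;λ) - φ̃₁(ρ;λ)`:
`ρ⁻³(1+ρ)^{1/2-λ}(2+ρ(-1+2λ)) - ρ⁻³(1-ρ)^{1/2-λ}(2+ρ(1-2λ))
  = -((3-2λ)(-1+2λ)(1+2λ)/4) ∫_{-1}^{1} ∫₀^{1} (1+ρt₁t₂)^{-3/2-λ} t₁² dt₂ dt₁`. -/
theorem phi0_double_integral_rep (l : ℂ) (ρ : ℝ) (hρ : ρ ∈ Ioo (0:ℝ) 1) :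
    ((ρ:ℂ)^3)⁻¹ * ((1 + ρ : ℝ) : ℂ) ^ ((1:ℂ)/2 - l) * (2 + (ρ:ℂ)*(-1 + 2*l))
      - ((ρ:ℂ)^3)⁻¹ * ((1 - ρ : ℝ) : ℂ) ^ ((1:ℂ)/2 - l) * (2 + (ρ:ℂ)*(1 - 2*l))
    = -((3 - 2*l) * (-1 + 2*l) * (1 + 2*l) / 4)
        * ∫ t₁ in (-1:ℝ)..1, ∫ t₂ in (0:ℝ)..1,
            ((1 + ρ*t₁*t₂ : ℝ) : ℂ) ^ (-(3:ℂ)/2 - l) * (t₁:ℂ)^2 := by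
  have key : (-(3:ℂ)/2 - l + 1) * ∫ t₁ in (-1:ℝ)..1, ∫ t₂ in (0:ℝ)..1,
      ((1 + ρ*t₁*t₂ : ℝ) : ℂ) ^ (-(3:ℂ)/2 - l) * (t₁:ℂ)^2
      = ∫ t in (-1:ℝ)..1, (t / ρ : ℂ) *
        (((1 + ρ * t : ℝ) : ℂ) ^ (-(3:ℂ)/2 - l + 1) - 1) := by
    rw [← intervalIntegral.integral_const_mul]
    refine intervalIntegral.integral_congr fun t ht => ?_
    rw [uIcc_of_le (by norm_num)] at ht
    exact integral_one_add_mul_cpow_mul_sq _ hρ ht.1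
  have outer := integral_mul_one_add_mul_cpow_sub_one (-(3:ℂ)/2 - l) hρ
  rw [← key, show -(3:ℂ)/2 - l + 2 = 1/2 - l by ring] at outer
  linear_combination 2 * outer
end

section
/- Let C > 0 and let f, g ∈ C²(ℝ, ℂ) with f odd, and suppose that |f^{(j)}(ω)| ≤ C ⟨ω⟩^{−1−j} and |g^{(j)}(ω)| ≤ C ⟨ω⟩^{−2−j} for j = 0, 1, 2 and all ω ∈ ℝ. Then for every a ∈ ℝ \ {0} the improper integral lim_{N→∞} ∫_{−N}^{N} e^{i a ω} (f(ω) + g(ω)) dω exists, and its modulus is at most C' ⟨a⟩^{−2}, where C' > 0 depends only on C (not on a, f, or g). -/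
open MeasureTheory Filter

theorem oscillatory_integral_by_parts {φ φ' : ℝ → ℂ} (hφ : ∀ x, HasDerivAt φ (φ' x) x)
    (hc : Continuous φ') (a s t : ℝ) :
    Complex.I * a * ∫ x in s..t, Complex.exp (Complex.I * a * x) * φ x =
      Complex.exp (Complex.I * a * t) * φ t - Complex.exp (Complex.I * a * s) * φ s -
        ∫ x in s..t, Complex.exp (Complex.I * a * x) * φ' x := by
  have hφc : Continuous φ := continuous_iff_continuousAt.2 fun x => (hφ x).continuousAt
  have hder : ∀ x : ℝ, HasDerivAt (fun x : ℝ => Complex.exp (Complex.I * a * x) * φ x)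
      (Complex.I * a * (Complex.exp (Complex.I * a * x) * φ x) +
        Complex.exp (Complex.I * a * x) * φ' x) x := fun x => by
    have h1 : HasDerivAt (fun x : ℝ => Complex.I * a * (x : ℂ)) (Complex.I * a * 1) x :=
      Complex.ofRealCLM.hasDerivAt.const_mul _
    exact (h1.cexp.fun_mul (hφ x)).congr_deriv (by ring)
  have key := intervalIntegral.integral_eq_sub_of_hasDerivAt (fun x _ => hder x)
    ((show Continuous fun x : ℝ => Complex.I * a * (Complex.exp (Complex.I * a * x) * φ x) +
        Complex.exp (Complex.I * a * x) * φ' x by fun_prop).intervalIntegrable s t)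
  rw [intervalIntegral.integral_add
    (Continuous.intervalIntegrable (by fun_prop) _ _)
    (Continuous.intervalIntegrable (by fun_prop) _ _),
    intervalIntegral.integral_const_mul] at key
  rw [← key]
  ring

theorem norm_exp_I_mul_mul (a x : ℝ) : ‖Complex.exp (Complex.I * a * x)‖ = 1 := by
  rw [mul_assoc, ← Complex.ofReal_mul, Complex.norm_exp_I_mul_ofReal]

theorem tendsto_zero_of_norm_mul_abs_le {l : Filter ℝ} {u : ℝ → ℂ} {K : ℝ}
    (hu : ∀ x, ‖u x‖ * |x| ≤ K) (hl : Tendsto (fun x : ℝ => |x|) l atTop) :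
    Tendsto u l (nhds 0) := by
  refine squeeze_zero_norm' ?_ (hl.const_div_atTop K)
  filter_upwards [hl.eventually_gt_atTop 0] with x hx
  exact (le_div_iff₀ hx).2 (hu x)

theorem norm_exp_I_mul_mul_mul (a x : ℝ) (z : ℂ) :
    ‖Complex.exp (Complex.I * a * x) * z‖ = ‖z‖ := by
  rw [norm_mul, norm_exp_I_mul_mul, one_mul]

theorem norm_integral_le_mul_pi {φ : ℝ → ℂ} {K : ℝ}
    (hφ : ∀ x, ‖φ x‖ ≤ K * (1 + x ^ 2)⁻¹) {s t : ℝ} (hst : s ≤ t) :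
    ‖∫ x in s..t, φ x‖ ≤ K * Real.pi := by
  have hK : 0 ≤ K := by simpa using (norm_nonneg _).trans (hφ 0)
  refine (intervalIntegral.norm_integral_le_of_norm_le hst (Eventually.of_forall fun x _ => hφ x)
    (integrable_inv_one_add_sq.const_mul K).intervalIntegrable).trans ?_
  rw [intervalIntegral.integral_const_mul, integral_inv_one_add_sq]
  refine mul_le_mul_of_nonneg_left ?_ hK
  linarith [Real.arctan_lt_pi_div_two t, Real.neg_pi_div_two_lt_arctan s]

/-- Two integrations by parts: existence of the improper oscillatory integral and its decay. -/
theorem exists_tendsto_oscillatory_integral {h h' h'' : ℝ → ℂ} {a K : ℝ} (ha : a ≠ 0)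
    (hh : ∀ x, HasDerivAt h (h' x) x) (hh' : ∀ x, HasDerivAt h' (h'' x) x)
    (hc : Continuous h'') (b0 : ∀ x, ‖h x‖ * |x| ≤ K) (b1 : ∀ x, ‖h' x‖ * |x| ≤ K)
    (b2 : ∀ x, ‖h'' x‖ ≤ K * (1 + x ^ 2)⁻¹) :
    ∃ L : ℂ, Tendsto (fun N : ℝ => ∫ x in (-N)..N, Complex.exp (Complex.I * a * x) * h x)
      atTop (nhds L) ∧ ‖L‖ ≤ K * Real.pi / a ^ 2 := by
  have hIa : Complex.I * (a : ℂ) ≠ 0 := mul_ne_zero Complex.I_ne_zero (by exact_mod_cast ha)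
  have hc' : Continuous h' := continuous_iff_continuousAt.2 fun x => (hh' x).continuousAt
  have hdom : ∀ x : ℝ, ‖Complex.exp (Complex.I * a * x) * h'' x‖ ≤ K * (1 + x ^ 2)⁻¹ :=
    fun x => (norm_exp_I_mul_mul_mul a x _).trans_le (b2 x)
  have hint : Integrable (fun x : ℝ => Complex.exp (Complex.I * a * x) * h'' x) :=
    (integrable_inv_one_add_sq.const_mul K).mono'
      (Continuous.aestronglyMeasurable (by fun_prop)) (Eventually.of_forall hdom)
  have hlim := intervalIntegral_tendsto_integral hint tendsto_neg_atTop_atBot tendsto_id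
  have bdry : ∀ {u : ℝ → ℂ}, (∀ x, ‖u x‖ * |x| ≤ K) →
      Tendsto (fun N : ℝ => Complex.exp (Complex.I * a * N) * u N -
        Complex.exp (Complex.I * a * (-N : ℝ)) * u (-N)) atTop (nhds 0) := by
    intro u hu
    have h1 : ∀ x : ℝ, ‖Complex.exp (Complex.I * a * x) * u x‖ * |x| ≤ K := fun x => by
      rw [norm_exp_I_mul_mul_mul]
      exact hu x
    simpa using (tendsto_zero_of_norm_mul_abs_le h1 tendsto_abs_atTop_atTop).sub
      ((tendsto_zero_of_norm_mul_abs_le h1 tendsto_abs_atBot_atTop).comp tendsto_neg_atTop_atBot)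
  have hL := ((bdry b0).sub
    (((bdry b1).sub hlim).const_mul (Complex.I * (a : ℂ))⁻¹)).const_mul (Complex.I * (a : ℂ))⁻¹
  refine ⟨_, hL.congr fun N => ?_, ?_⟩
  · have e0 := oscillatory_integral_by_parts hh hc' a (-N) N
    have e1 := oscillatory_integral_by_parts hh' hc a (-N) N
    simp only [id]
    rw [← e1, inv_mul_cancel_left₀ hIa, ← e0, inv_mul_cancel_left₀ hIa]
  · have hb : ‖∫ x : ℝ, Complex.exp (Complex.I * a * x) * h'' x‖ ≤ K * Real.pi := by
      refine le_of_tendsto hlim.norm ?_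
      filter_upwards [eventually_ge_atTop 0] with N hN
      exact norm_integral_le_mul_pi hdom (by simp only [id]; linarith)
    simp only [zero_sub, mul_neg, neg_neg, norm_mul, norm_inv, Complex.norm_I, one_mul,
      Complex.norm_real, Real.norm_eq_abs]
    rw [← sq_abs a, div_eq_inv_mul, sq, mul_inv, mul_assoc]
    gcongr

theorem norm_oscillatory_tail_le {f f' : ℝ → ℂ} {a C R N : ℝ} (ha : a ≠ 0) (hR : 0 < R)
    (hRN : R ≤ N) (hf : ∀ x, HasDerivAt f (f' x) x) (hc : Continuous f')
    (b0 : ∀ x, ‖f x‖ * |x| ≤ C) (b1 : ∀ x, ‖f' x‖ ≤ C * (1 + x ^ 2)⁻¹) :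
    ‖∫ x in R..N, Complex.exp (Complex.I * a * x) * f x‖ ≤ 2 * C / (|a| * R) := by
  have hN : 0 < N := hR.trans_le hRN
  have hC : 0 ≤ C := by simpa using (norm_nonneg _).trans (b1 0)
  have hpt : ∀ x : ℝ, 0 < x → ‖f x‖ ≤ C / x := fun x hx => by
    rw [le_div_iff₀ hx]
    simpa [abs_of_pos hx] using b0 x
  have h0 : (0 : ℝ) ∉ Set.uIcc R N := by
    rw [Set.uIcc_of_le hRN]
    exact fun h => hR.not_ge h.1
  have hI : ‖∫ x in R..N, Complex.exp (Complex.I * a * x) * f' x‖ ≤ C / R - C / N := by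
    have hle : ∀ x ∈ Set.Ioc R N,
        ‖Complex.exp (Complex.I * a * x) * f' x‖ ≤ C * x ^ (-2 : ℤ) := fun x hx => by
      have hx0 : 0 < x := hR.trans hx.1
      rw [norm_exp_I_mul_mul_mul]
      refine (b1 x).trans (mul_le_mul_of_nonneg_left ?_ hC)
      rw [zpow_neg]
      norm_cast
      exact inv_anti₀ (by positivity) (by linarith)
    refine (intervalIntegral.norm_integral_le_of_norm_le hRN (Eventually.of_forall hle)
      ((intervalIntegral.intervalIntegrable_zpow (Or.inr h0)).const_mul C)).trans_eq ?_
    rw [intervalIntegral.integral_const_mul, integral_zpow (Or.inr ⟨by norm_num, h0⟩)]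
    norm_num
    ring
  have e := congrArg norm (oscillatory_integral_by_parts hf hc a R N)
  rw [norm_mul, norm_mul, Complex.norm_I, one_mul, Complex.norm_real, Real.norm_eq_abs] at e
  rw [mul_comm |a|, ← div_div, le_div_iff₀' (abs_pos.2 ha), e]
  refine (norm_sub_le _ _).trans ((add_le_add_left (norm_sub_le _ _) _).trans ?_)
  rw [norm_exp_I_mul_mul_mul, norm_exp_I_mul_mul_mul, mul_div_assoc]
  linarith [hpt R hR, hpt N hN]

/-- Uniform bound for truncated oscillatory integrals of odd functions of size `O(1/|x|)`. -/
theorem norm_oscillatory_integral_odd_le {f f' : ℝ → ℂ} {a C N : ℝ} (ha : a ≠ 0)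
    (hN : |a|⁻¹ ≤ N) (hodd : ∀ x, f (-x) = -f x)
    (hf : ∀ x, HasDerivAt f (f' x) x) (hc : Continuous f')
    (b0 : ∀ x, ‖f x‖ * |x| ≤ C) (b1 : ∀ x, ‖f' x‖ ≤ C * (1 + x ^ 2)⁻¹) :
    ‖∫ x in (-N)..N, Complex.exp (Complex.I * a * x) * f x‖ ≤ 6 * C := by
  have hfc : Continuous f := continuous_iff_continuousAt.2 fun x => (hf x).continuousAt
  have ha' : 0 < |a| := abs_pos.2 ha
  set R : ℝ := |a|⁻¹
  have hR : 0 < R := inv_pos.2 ha'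
  have haR : |a| * R = 1 := mul_inv_cancel₀ ha'.ne'
  have hii : ∀ s t : ℝ, IntervalIntegrable
      (fun x : ℝ => Complex.exp (Complex.I * a * x) * f x) volume s t :=
    fun s t => Continuous.intervalIntegrable (by fun_prop) _ _
  have right := norm_oscillatory_tail_le ha hR hN hf hc b0 b1
  have left : ‖∫ x in (-N)..(-R), Complex.exp (Complex.I * a * x) * f x‖ ≤ 2 * C := by
    have h := norm_oscillatory_tail_le (neg_ne_zero.2 ha) hR hN hf hc b0 b1
    rw [abs_neg, haR, div_one] at h
    rw [← intervalIntegral.integral_comp_neg]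
    simpa [hodd, intervalIntegral.integral_neg] using h
  have hzero : ∫ x in (-R)..R, f x = 0 := by
    have h := intervalIntegral.integral_comp_neg (a := -R) (b := R) f
    simp only [hodd, neg_neg, intervalIntegral.integral_neg] at h
    exact neg_eq_self.1 h
  have mid : ‖∫ x in (-R)..R, Complex.exp (Complex.I * a * x) * f x‖ ≤ 2 * C := by
    have e : ∫ x in (-R)..R, Complex.exp (Complex.I * a * x) * f x =
        ∫ x in (-R)..R, (Complex.exp (Complex.I * a * x) - 1) * f x := by
      simp only [sub_mul, one_mul]
      rw [intervalIntegral.integral_sub (hii _ _) (hfc.intervalIntegrable _ _), hzero, sub_zero]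
    rw [e]
    refine (intervalIntegral.norm_integral_le_of_norm_le_const (C := |a| * C) fun x _ => ?_).trans
      (le_of_eq ?_)
    · have h := Real.norm_exp_I_mul_ofReal_sub_one_le (x := a * x)
      rw [Complex.ofReal_mul, ← mul_assoc, Real.norm_eq_abs, abs_mul] at h
      rw [norm_mul]
      calc _ ≤ |a| * |x| * ‖f x‖ := by gcongr
        _ = |a| * (‖f x‖ * |x|) := by ring
        _ ≤ |a| * C := by gcongr; exact b0 x
    · rw [sub_neg_eq_add, abs_of_pos (add_pos hR hR)]
      linear_combination (2 * C) * haR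
  rw [haR, div_one] at right
  rw [← intervalIntegral.integral_add_adjacent_intervals (hii (-N) (-R)) (hii (-R) N),
    ← intervalIntegral.integral_add_adjacent_intervals (hii (-R) R) (hii R N)]
  refine (norm_add_le _ _).trans ((add_le_add_right (norm_add_le _ _) _).trans ?_)
  linarith

theorem sqrt_one_add_sq_rpow_neg_two (x : ℝ) :
    Real.sqrt (1 + x ^ 2) ^ (-(2 : ℝ)) = (1 + x ^ 2)⁻¹ := by
  rw [Real.rpow_neg (Real.sqrt_nonneg _), Real.rpow_two, Real.sq_sqrt (by positivity)]

theorem sqrt_one_add_sq_rpow_le_inv (x : ℝ) {p : ℝ} (hp : p ≤ -2) :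
    Real.sqrt (1 + x ^ 2) ^ p ≤ (1 + x ^ 2)⁻¹ := by
  rw [← sqrt_one_add_sq_rpow_neg_two]
  exact Real.rpow_le_rpow_of_exponent_le (Real.one_le_sqrt.2 (by nlinarith [sq_nonneg x])) hp

theorem sqrt_one_add_sq_rpow_mul_abs_le_one (x : ℝ) {p : ℝ} (hp : p ≤ -1) :
    Real.sqrt (1 + x ^ 2) ^ p * |x| ≤ 1 := by
  have h1 : 1 ≤ Real.sqrt (1 + x ^ 2) := Real.one_le_sqrt.2 (by nlinarith [sq_nonneg x])
  have h2 : |x| ≤ Real.sqrt (1 + x ^ 2) := Real.abs_le_sqrt (by linarith)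
  calc _ ≤ Real.sqrt (1 + x ^ 2) ^ (-1 : ℝ) * Real.sqrt (1 + x ^ 2) := by gcongr
    _ = 1 := by rw [Real.rpow_neg_one, inv_mul_cancel₀ (by linarith)]

theorem hasDerivAt_iteratedDeriv_of_contDiff_two {f : ℝ → ℂ} (hf : ContDiff ℝ 2 f) :
    (∀ x, HasDerivAt f (iteratedDeriv 1 f x) x) ∧
    (∀ x, HasDerivAt (iteratedDeriv 1 f) (iteratedDeriv 2 f x) x) ∧
    Continuous (iteratedDeriv 2 f) := by
  refine ⟨fun x => ?_, fun x => ?_, hf.continuous_iteratedDeriv 2 le_rfl⟩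
  · rw [iteratedDeriv_one]
    exact (hf.differentiable (by norm_num) x).hasDerivAt
  · rw [iteratedDeriv_succ (n := 1)]
    exact (hf.differentiable_iteratedDeriv 1 (by norm_num) x).hasDerivAt

/-- Oscillatory integral bound: if `f` is odd with `|f⁽ʲ⁾(ω)| ≤ C⟨ω⟩^{-1-j}` and
`|g⁽ʲ⁾(ω)| ≤ C⟨ω⟩^{-2-j}` for `j = 0,1,2`, then for every `a ≠ 0` the improper
integral `∫_ℝ e^{iaω}(f(ω)+g(ω)) dω` exists and is `≤ C'⟨a⟩^{-2}` in modulus,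
with `C'` depending only on `C`. -/
theorem oscillatory_integral_odd_symbol (C : ℝ) (hC : 0 < C) :
    ∃ C' > (0:ℝ), ∀ (f g : ℝ → ℂ) (a : ℝ), a ≠ 0 →
      ContDiff ℝ 2 f → ContDiff ℝ 2 g →
      (∀ ω : ℝ, f (-ω) = -f ω) →
      (∀ j : ℕ, j ≤ 2 → ∀ ω : ℝ,
        ‖iteratedDeriv j f ω‖ ≤ C * Real.sqrt (1 + ω^2) ^ (-(1:ℝ) - (j:ℝ))) →
      (∀ j : ℕ, j ≤ 2 → ∀ ω : ℝ,
        ‖iteratedDeriv j g ω‖ ≤ C * Real.sqrt (1 + ω^2) ^ (-(2:ℝ) - (j:ℝ))) →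
      ∃ L : ℂ,
        Tendsto (fun N : ℝ => ∫ ω in (-N)..N,
            Complex.exp (Complex.I * (a:ℂ) * (ω:ℂ)) * (f ω + g ω))
          atTop (nhds L) ∧
        ‖L‖ ≤ C' * Real.sqrt (1 + a^2) ^ (-(2:ℝ)) := by
  refine ⟨20 * C, by positivity, fun f g a ha hf hg hodd bf bg => ?_⟩
  obtain ⟨df, df', cf⟩ := hasDerivAt_iteratedDeriv_of_contDiff_two hf
  obtain ⟨dg, dg', cg⟩ := hasDerivAt_iteratedDeriv_of_contDiff_two hg
  have decay : ∀ {u : ℂ} {x p : ℝ}, ‖u‖ ≤ C * Real.sqrt (1 + x ^ 2) ^ p → p ≤ -1 →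
      ‖u‖ * |x| ≤ C := fun {u x p} hu hp => by
    calc ‖u‖ * |x| ≤ C * Real.sqrt (1 + x ^ 2) ^ p * |x| := by gcongr
      _ = C * (Real.sqrt (1 + x ^ 2) ^ p * |x|) := mul_assoc _ _ _
      _ ≤ C * 1 := by gcongr; exact sqrt_one_add_sq_rpow_mul_abs_le_one x hp
      _ = C := mul_one C
  have decay_sq : ∀ {u : ℂ} {x p : ℝ}, ‖u‖ ≤ C * Real.sqrt (1 + x ^ 2) ^ p → p ≤ -2 →
      ‖u‖ ≤ C * (1 + x ^ 2)⁻¹ := fun {u x p} hu hp =>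
    hu.trans (by gcongr; exact sqrt_one_add_sq_rpow_le_inv x hp)
  have f0 : ∀ x, ‖f x‖ * |x| ≤ C := fun x =>
    decay (by simpa only [iteratedDeriv_zero] using bf 0 (by norm_num) x) (by norm_num)
  have f1 : ∀ x, ‖iteratedDeriv 1 f x‖ * |x| ≤ C := fun x =>
    decay (bf 1 (by norm_num) x) (by norm_num)
  have f1' : ∀ x, ‖iteratedDeriv 1 f x‖ ≤ C * (1 + x ^ 2)⁻¹ := fun x =>
    decay_sq (bf 1 (by norm_num) x) (by norm_num)
  have f2 : ∀ x, ‖iteratedDeriv 2 f x‖ ≤ C * (1 + x ^ 2)⁻¹ := fun x =>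
    decay_sq (bf 2 (by norm_num) x) (by norm_num)
  have g0 : ∀ x, ‖g x‖ * |x| ≤ C := fun x =>
    decay (by simpa only [iteratedDeriv_zero] using bg 0 (by norm_num) x) (by norm_num)
  have g0' : ∀ x, ‖g x‖ ≤ C * (1 + x ^ 2)⁻¹ := fun x =>
    decay_sq (by simpa only [iteratedDeriv_zero] using bg 0 (by norm_num) x) (by norm_num)
  have g1 : ∀ x, ‖iteratedDeriv 1 g x‖ * |x| ≤ C := fun x =>
    decay (bg 1 (by norm_num) x) (by norm_num)
  have g2 : ∀ x, ‖iteratedDeriv 2 g x‖ ≤ C * (1 + x ^ 2)⁻¹ := fun x =>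
    decay_sq (bg 2 (by norm_num) x) (by norm_num)
  have add_mul_le : ∀ {u v : ℂ} {x : ℝ}, ‖u‖ * |x| ≤ C → ‖v‖ * |x| ≤ C →
      ‖u + v‖ * |x| ≤ 2 * C := fun {u v x} hu hv => by
    have := mul_le_mul_of_nonneg_right (norm_add_le u v) (abs_nonneg x)
    linarith
  obtain ⟨L, hL, hLb⟩ := exists_tendsto_oscillatory_integral (K := 2 * C) ha
    (fun x => (df x).fun_add (dg x)) (fun x => (df' x).fun_add (dg' x)) (cf.add cg)
    (fun x => add_mul_le (f0 x) (g0 x)) (fun x => add_mul_le (f1 x) (g1 x))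
    (fun x => (norm_add_le _ _).trans (by linarith [f2 x, g2 x]))
  refine ⟨L, hL, ?_⟩
  rw [sqrt_one_add_sq_rpow_neg_two, ← div_eq_mul_inv, le_div_iff₀ (by positivity)]
  have hpi := Real.pi_lt_four
  rcases le_total 1 |a| with h1 | h1
  · have ha2 : 1 ≤ a ^ 2 := (one_le_sq_iff_one_le_abs a).2 h1
    rw [le_div_iff₀ (by positivity)] at hLb
    nlinarith [mul_le_mul_of_nonneg_left ha2 (norm_nonneg L), mul_lt_mul_of_pos_left hpi hC]
  · have ha2 : a ^ 2 ≤ 1 := (sq_le_one_iff_abs_le_one a).2 h1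
    have hb : ‖L‖ ≤ 6 * C + C * Real.pi := by
      refine le_of_tendsto hL.norm ?_
      filter_upwards [eventually_ge_atTop |a|⁻¹] with N hN
      have hN0 : 0 ≤ N := (inv_nonneg.2 (abs_nonneg a)).trans hN
      have hfc := hf.continuous
      have hgc := hg.continuous
      simp only [mul_add]
      rw [intervalIntegral.integral_add (Continuous.intervalIntegrable (by fun_prop) _ _)
        (Continuous.intervalIntegrable (by fun_prop) _ _)]
      refine (norm_add_le _ _).trans (add_le_add
        (norm_oscillatory_integral_odd_le ha hN hodd df
          (hf.continuous_iteratedDeriv 1 (by norm_num)) f0 f1')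
        (norm_integral_le_mul_pi (fun x => ?_) (by linarith)))
      exact (norm_exp_I_mul_mul_mul a x _).trans_le (g0' x)
    nlinarith [mul_le_mul_of_nonneg_left ha2 (norm_nonneg L), mul_lt_mul_of_pos_left hpi hC]
end

section
/- Let α ∈ (0,1), C > 0, and let f ∈ C³(ℝ, ℂ) satisfy |f^{(j)}(ω)| ≤ C ⟨ω⟩^{−α−j} for j = 0, 1, 2, 3 and all ω ∈ ℝ. Then for every a ∈ ℝ \ {0} the improper integral lim_{N→∞} ∫_{−N}^{N} e^{i a ω} f(ω) dω exists, and its modulus is at most C' |a|^{−1+α} ⟨a⟩^{−2}, where C' > 0 depends only on α and C. -/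
open MeasureTheory Filter

theorem sqrt_one_add_sq_rpow_neg_le {s ω : ℝ} (hs : 0 ≤ s) (hω : 0 < |ω|) :
    Real.sqrt (1 + ω ^ 2) ^ (-s) ≤ |ω| ^ (-s) :=
  Real.rpow_le_rpow_of_nonpos hω (Real.abs_le_sqrt (by linarith)) (by linarith)

theorem integrable_sqrt_one_add_sq_rpow_neg {s : ℝ} (hs : 1 < s) :
    Integrable fun ω : ℝ => Real.sqrt (1 + ω ^ 2) ^ (-s) := by
  have h := integrable_rpow_neg_one_add_norm_sq (E := ℝ) (μ := volume) (r := s) (by simpa using hs)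
  refine h.congr (Eventually.of_forall fun ω => ?_)
  simp only [Real.norm_eq_abs, sq_abs]
  rw [Real.sqrt_eq_rpow, ← Real.rpow_mul (by positivity)]
  ring_nf

theorem norm_exp_I_mul_ofReal_mul_ofReal (a ω : ℝ) :
    ‖Complex.exp (Complex.I * (a : ℂ) * (ω : ℂ))‖ = 1 := by
  rw [show Complex.I * (a : ℂ) * (ω : ℂ) = ((a * ω : ℝ) : ℂ) * Complex.I by push_cast; ring]
  exact Complex.norm_exp_ofReal_mul_I _

theorem integral_exp_mul_eq_sub {f : ℝ → ℂ} (hf : ContDiff ℝ 1 f) {a : ℝ} (ha : a ≠ 0) (x y : ℝ) :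
    ∫ ω in x..y, Complex.exp (Complex.I * (a : ℂ) * (ω : ℂ)) * f ω =
      Complex.exp (Complex.I * (a : ℂ) * (y : ℂ)) / (Complex.I * a) * f y
        - Complex.exp (Complex.I * (a : ℂ) * (x : ℂ)) / (Complex.I * a) * f x
        - (Complex.I * a)⁻¹ *
          ∫ ω in x..y, Complex.exp (Complex.I * (a : ℂ) * (ω : ℂ)) * deriv f ω := by
  have hc : Complex.I * (a : ℂ) ≠ 0 := by simp [ha]
  have hd : ∀ ω : ℝ, HasDerivAt
      (fun ω : ℝ => Complex.exp (Complex.I * (a : ℂ) * (ω : ℂ)) / (Complex.I * a))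
      (Complex.exp (Complex.I * (a : ℂ) * (ω : ℂ))) ω := by
    intro ω
    have h := (((hasDerivAt_id (ω : ℂ)).const_mul (Complex.I * (a : ℂ))).cexp.div_const
      (Complex.I * a)).comp_ofReal
    simpa [hc] using h
  have hf' : Continuous (deriv f) := hf.continuous_deriv le_rfl
  have h := intervalIntegral.integral_deriv_mul_eq_sub (a := x) (b := y)
    (u := fun ω : ℝ => Complex.exp (Complex.I * (a : ℂ) * (ω : ℂ)) / (Complex.I * a))
    (v := f) (fun ω _ => hd ω)
    (fun ω _ => (hf.differentiable one_ne_zero ω).hasDerivAt)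
    (Continuous.intervalIntegrable (by fun_prop) _ _) (hf'.intervalIntegrable _ _)
  rw [intervalIntegral.integral_add (Continuous.intervalIntegrable
      (by have := hf.continuous; fun_prop) _ _)
    (Continuous.intervalIntegrable (by fun_prop) _ _)] at h
  rw [← h, ← intervalIntegral.integral_const_mul]
  simp only [div_eq_inv_mul, mul_assoc]
  ring

theorem tendsto_integral_exp_mul_of_integrable {f : ℝ → ℂ} (hf : Integrable f) (a : ℝ) :
    Tendsto (fun N : ℝ => ∫ ω in (-N)..N, Complex.exp (Complex.I * (a : ℂ) * (ω : ℂ)) * f ω) atTop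
      (nhds (∫ ω : ℝ, Complex.exp (Complex.I * (a : ℂ) * (ω : ℂ)) * f ω)) := by
  refine intervalIntegral_tendsto_integral ?_ tendsto_neg_atTop_atBot tendsto_id
  exact hf.bdd_mul (c := 1) (Continuous.aestronglyMeasurable (by fun_prop))
    (Eventually.of_forall fun ω => (norm_exp_I_mul_ofReal_mul_ofReal a ω).le)

theorem tendsto_integral_exp_mul_of_integrable_deriv {f : ℝ → ℂ} (hf : ContDiff ℝ 1 f)
    (hf' : Integrable (deriv f)) (htop : Tendsto f atTop (nhds 0))
    (hbot : Tendsto f atBot (nhds 0)) {a : ℝ} (ha : a ≠ 0) :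
    Tendsto (fun N : ℝ => ∫ ω in (-N)..N, Complex.exp (Complex.I * (a : ℂ) * (ω : ℂ)) * f ω) atTop
      (nhds (-(Complex.I * a)⁻¹ *
        ∫ ω : ℝ, Complex.exp (Complex.I * (a : ℂ) * (ω : ℂ)) * deriv f ω)) := by
  have hb : ∀ {l : Filter ℝ}, Tendsto f l (nhds 0) → Tendsto (fun ω : ℝ =>
      Complex.exp (Complex.I * (a : ℂ) * (ω : ℂ)) / (Complex.I * a) * f ω) l (nhds 0) := by
    intro l hl
    refine squeeze_zero_norm (a := fun ω => |a|⁻¹ * ‖f ω‖) (fun ω => ?_) ?_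
    · rw [norm_mul, norm_div, norm_exp_I_mul_ofReal_mul_ofReal]
      simp
    · simpa using hl.norm.const_mul |a|⁻¹
  have h := ((hb htop).sub ((hb hbot).comp tendsto_neg_atTop_atBot)).sub
    ((tendsto_integral_exp_mul_of_integrable hf' a).const_mul (Complex.I * (a : ℂ))⁻¹)
  rw [sub_zero, zero_sub, ← neg_mul] at h
  refine h.congr fun N => ?_
  rw [integral_exp_mul_eq_sub hf ha]
  rfl

/-- Whole-line integration by parts against `e^{iaω}`. -/
theorem integral_exp_mul_eq_neg_inv_mul {f : ℝ → ℂ} (hf : ContDiff ℝ 1 f) (hfi : Integrable f)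
    (hf' : Integrable (deriv f)) (htop : Tendsto f atTop (nhds 0))
    (hbot : Tendsto f atBot (nhds 0)) {a : ℝ} (ha : a ≠ 0) :
    ∫ ω : ℝ, Complex.exp (Complex.I * (a : ℂ) * (ω : ℂ)) * f ω =
      -(Complex.I * a)⁻¹ * ∫ ω : ℝ, Complex.exp (Complex.I * (a : ℂ) * (ω : ℂ)) * deriv f ω :=
  tendsto_nhds_unique (tendsto_integral_exp_mul_of_integrable hfi a)
    (tendsto_integral_exp_mul_of_integrable_deriv hf hf' htop hbot ha)

theorem norm_integral_exp_mul_le_of_norm_le_rpow {α C : ℝ} (hα : α ∈ Set.Ioo (0 : ℝ) 1)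
    (hC : 0 < C) {f : ℝ → ℂ} (hf : ContDiff ℝ 1 f)
    (h0 : ∀ ω > 0, ‖f ω‖ ≤ C * ω ^ (-α)) (h1 : ∀ ω > 0, ‖deriv f ω‖ ≤ C * ω ^ (-α - 1))
    {a : ℝ} (ha : a ≠ 0) {N : ℝ} (hN : |a|⁻¹ ≤ N) :
    ‖∫ ω in (0 : ℝ)..N, Complex.exp (Complex.I * (a : ℂ) * (ω : ℂ)) * f ω‖ ≤
      C * (1 / (1 - α) + 2 + 1 / α) * |a| ^ (-1 + α) := by
  obtain ⟨hα0, hα1⟩ := hα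
  have hapos : 0 < |a| := abs_pos.mpr ha
  set R := |a|⁻¹ with hR
  have hRpos : 0 < R := inv_pos.mpr hapos
  have hNpos : 0 < N := hRpos.trans_le hN
  have hcont : Continuous fun ω : ℝ => Complex.exp (Complex.I * (a : ℂ) * (ω : ℂ)) * f ω := by
    have := hf.continuous
    fun_prop
  have hRα : R ^ (1 - α) = |a| ^ (-1 + α) := by
    rw [hR, Real.inv_rpow hapos.le, ← Real.rpow_neg hapos.le]
    ring_nf
  have hRα' : |a|⁻¹ * R ^ (-α) = |a| ^ (-1 + α) := by
    rw [← hRα, ← hR, sub_eq_add_neg, Real.rpow_add hRpos, Real.rpow_one]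
  have hin : ‖∫ ω in (0 : ℝ)..R, Complex.exp (Complex.I * (a : ℂ) * (ω : ℂ)) * f ω‖ ≤
      C * (1 / (1 - α)) * |a| ^ (-1 + α) := by
    have h := intervalIntegral.norm_integral_le_of_norm_le (μ := volume) hRpos.le
      (f := fun ω : ℝ => Complex.exp (Complex.I * (a : ℂ) * (ω : ℂ)) * f ω)
      (g := fun ω => C * ω ^ (-α))
      (Eventually.of_forall fun ω hω => by
        rw [norm_mul, norm_exp_I_mul_ofReal_mul_ofReal, one_mul]
        exact h0 ω hω.1)
      ((intervalIntegral.intervalIntegrable_rpow' (by linarith)).const_mul C)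
    refine h.trans_eq ?_
    rw [intervalIntegral.integral_const_mul, integral_rpow (Or.inl (by linarith)),
      Real.zero_rpow (by linarith), ← hRα]
    ring_nf
  have htail : ‖∫ ω in R..N, Complex.exp (Complex.I * (a : ℂ) * (ω : ℂ)) * deriv f ω‖ ≤
      C * (1 / α) * R ^ (-α) := by
    have hmem : (0 : ℝ) ∉ Set.uIcc R N := by
      rw [Set.uIcc_of_le hN]
      exact fun h => hRpos.not_ge h.1
    have h := intervalIntegral.norm_integral_le_of_norm_le (μ := volume) hN
      (f := fun ω : ℝ => Complex.exp (Complex.I * (a : ℂ) * (ω : ℂ)) * deriv f ω)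
      (g := fun ω => C * ω ^ (-α - 1))
      (Eventually.of_forall fun ω hω => by
        rw [norm_mul, norm_exp_I_mul_ofReal_mul_ofReal, one_mul]
        exact h1 ω (hRpos.trans hω.1))
      ((intervalIntegral.intervalIntegrable_rpow (Or.inr hmem)).const_mul C)
    refine h.trans ?_
    rw [intervalIntegral.integral_const_mul,
      integral_rpow (Or.inr ⟨by linarith, hmem⟩), mul_assoc C]
    have hNα : 0 ≤ N ^ (-α) := by positivity
    gcongr
    rw [sub_add_cancel, div_neg, ← neg_div, one_div, inv_mul_eq_div]
    gcongr
    linarith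
  have hbd : ∀ ω, R ≤ ω →
      ‖Complex.exp (Complex.I * (a : ℂ) * (ω : ℂ)) / (Complex.I * a) * f ω‖ ≤
        |a|⁻¹ * (C * R ^ (-α)) := by
    intro ω hω
    rw [norm_mul, norm_div, norm_exp_I_mul_ofReal_mul_ofReal, norm_mul, Complex.norm_I,
      Complex.norm_real, Real.norm_eq_abs, one_mul, one_div]
    gcongr
    refine (h0 ω (hRpos.trans_le hω)).trans ?_
    gcongr ?_ * ?_
    exact Real.rpow_le_rpow_of_nonpos hRpos hω (by linarith)
  rw [← intervalIntegral.integral_add_adjacent_intervals (hcont.intervalIntegrable 0 R)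
    (hcont.intervalIntegrable R N), integral_exp_mul_eq_sub hf ha R N]
  have hlast : ‖(Complex.I * (a : ℂ))⁻¹ *
      ∫ ω in R..N, Complex.exp (Complex.I * (a : ℂ) * (ω : ℂ)) * deriv f ω‖ ≤
      |a|⁻¹ * (C * (1 / α) * R ^ (-α)) := by
    rw [norm_mul, norm_inv, norm_mul, Complex.norm_I, Complex.norm_real, Real.norm_eq_abs, one_mul]
    gcongr
  calc _ ≤ C * (1 / (1 - α)) * |a| ^ (-1 + α) + (|a|⁻¹ * (C * R ^ (-α)) + |a|⁻¹ * (C * R ^ (-α))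
        + |a|⁻¹ * (C * (1 / α) * R ^ (-α))) :=
      (norm_add_le _ _).trans (add_le_add hin ((norm_sub_le _ _).trans (add_le_add
        ((norm_sub_le _ _).trans (add_le_add (hbd N hN) (hbd R le_rfl))) hlast)))
    _ = C * (1 / (1 - α) + 2 + 1 / α) * |a| ^ (-1 + α) := by
      rw [← hRα']
      ring

theorem norm_symmetric_integral_exp_mul_le_of_norm_le_rpow {α C : ℝ} (hα : α ∈ Set.Ioo (0 : ℝ) 1)
    (hC : 0 < C) {f : ℝ → ℂ} (hf : ContDiff ℝ 1 f)
    (h0 : ∀ ω ≠ 0, ‖f ω‖ ≤ C * |ω| ^ (-α)) (h1 : ∀ ω ≠ 0, ‖deriv f ω‖ ≤ C * |ω| ^ (-α - 1))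
    {a : ℝ} (ha : a ≠ 0) {N : ℝ} (hN : |a|⁻¹ ≤ N) :
    ‖∫ ω in (-N)..N, Complex.exp (Complex.I * (a : ℂ) * (ω : ℂ)) * f ω‖ ≤
      2 * (C * (1 / (1 - α) + 2 + 1 / α)) * |a| ^ (-1 + α) := by
  have hcont : Continuous fun ω : ℝ => Complex.exp (Complex.I * (a : ℂ) * (ω : ℂ)) * f ω := by
    have := hf.continuous
    fun_prop
  have hpos := norm_integral_exp_mul_le_of_norm_le_rpow hα hC hf
    (fun ω hω => by simpa [abs_of_pos hω] using h0 ω hω.ne')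
    (fun ω hω => by simpa [abs_of_pos hω] using h1 ω hω.ne') ha hN
  have hneg := norm_integral_exp_mul_le_of_norm_le_rpow (f := fun ω => f (-ω)) hα hC
    (hf.comp contDiff_neg)
    (fun ω hω => by simpa [abs_of_pos hω] using h0 (-ω) (neg_ne_zero.mpr hω.ne'))
    (fun ω hω => by
      simpa [deriv_comp_neg, abs_of_pos hω] using h1 (-ω) (neg_ne_zero.mpr hω.ne'))
    (neg_ne_zero.mpr ha) (by simpa using hN)
  rw [abs_neg] at hneg
  have hrefl : ∫ ω in (-N)..0, Complex.exp (Complex.I * (a : ℂ) * (ω : ℂ)) * f ω =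
      ∫ ω in (0 : ℝ)..N, Complex.exp (Complex.I * ((-a : ℝ) : ℂ) * (ω : ℂ)) * f (-ω) := by
    have h := intervalIntegral.integral_comp_neg (a := 0) (b := N)
      (fun ω : ℝ => Complex.exp (Complex.I * (a : ℂ) * (ω : ℂ)) * f ω)
    rw [neg_zero] at h
    rw [← h]
    simp
  rw [← intervalIntegral.integral_add_adjacent_intervals (hcont.intervalIntegrable (-N) 0)
    (hcont.intervalIntegrable 0 N), hrefl]
  refine (norm_add_le _ _).trans ((add_le_add hneg hpos).trans_eq ?_)
  ring

theorem le_mul_rpow_mul_sqrt_rpow_neg_two {α K M x a : ℝ} (hα : 0 < α) (hM : 0 ≤ M)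
    (hK : 0 ≤ K) (ha : a ≠ 0) (h1 : x ≤ K * |a| ^ (-1 + α)) (h3 : x ≤ M * |a|⁻¹ ^ 3) :
    x ≤ 2 * (K + M) * |a| ^ (-1 + α) * Real.sqrt (1 + a ^ 2) ^ (-(2 : ℝ)) := by
  have hapos : 0 < |a| := abs_pos.mpr ha
  have hs : Real.sqrt (1 + a ^ 2) ^ (-(2 : ℝ)) = (1 + a ^ 2)⁻¹ := by
    rw [Real.rpow_neg (Real.sqrt_nonneg _), Real.rpow_two, Real.sq_sqrt (by positivity)]
  rw [hs, ← div_eq_mul_inv, le_div_iff₀ (by positivity)]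
  have hsq : |a| ^ 2 = a ^ 2 := sq_abs a
  rcases le_total |a| 1 with h | h
  · have : a ^ 2 ≤ 1 := by nlinarith
    have hKp : 0 ≤ K * |a| ^ (-1 + α) := by positivity
    have hMp : 0 ≤ M * |a| ^ (-1 + α) := by positivity
    nlinarith [mul_le_mul_of_nonneg_right h1 (by positivity : 0 ≤ 1 + a ^ 2)]
  · have hle : |a|⁻¹ ≤ |a| ^ (-1 + α) := by
      rw [← Real.rpow_neg_one]
      exact Real.rpow_le_rpow_of_exponent_le h (by linarith)
    have h2 : 1 + a ^ 2 ≤ 2 * |a| ^ 2 := by nlinarith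
    calc x * (1 + a ^ 2) ≤ M * |a|⁻¹ ^ 3 * (1 + a ^ 2) := by gcongr
      _ ≤ M * |a|⁻¹ ^ 3 * (2 * |a| ^ 2) := by gcongr
      _ = 2 * M * |a|⁻¹ := by field_simp
      _ ≤ 2 * (K + M) * |a| ^ (-1 + α) := by gcongr; linarith

/-- Oscillatory integral bound for symbols of order `-α`, `α ∈ (0,1)`: if
`|f⁽ʲ⁾(ω)| ≤ C⟨ω⟩^{-α-j}` for `j = 0,1,2,3`, then for every `a ≠ 0` the improper
integral `∫_ℝ e^{iaω} f(ω) dω` exists and is `≤ C'|a|^{-1+α}⟨a⟩^{-2}` in modulus,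
with `C'` depending only on `α` and `C`. -/
theorem oscillatory_integral_fractional_symbol
    (α : ℝ) (hα : α ∈ Set.Ioo (0:ℝ) 1) (C : ℝ) (hC : 0 < C) :
    ∃ C' > (0:ℝ), ∀ (f : ℝ → ℂ) (a : ℝ), a ≠ 0 →
      ContDiff ℝ 3 f →
      (∀ j : ℕ, j ≤ 3 → ∀ ω : ℝ,
        ‖iteratedDeriv j f ω‖ ≤ C * Real.sqrt (1 + ω^2) ^ (-α - (j:ℝ))) →
      ∃ L : ℂ,
        Tendsto (fun N : ℝ => ∫ ω in (-N)..N,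
            Complex.exp (Complex.I * (a:ℂ) * (ω:ℂ)) * f ω)
          atTop (nhds L) ∧
        ‖L‖ ≤ C' * |a| ^ (-1 + α) * Real.sqrt (1 + a^2) ^ (-(2:ℝ)) := by
  obtain ⟨hα0, hα1⟩ := hα
  set K := 2 * (C * (1 / (1 - α) + 2 + 1 / α)) with hK
  set M := C * ∫ ω : ℝ, Real.sqrt (1 + ω ^ 2) ^ (-(α + 3)) with hM
  have hKpos : 0 < K := by
    have : 0 < 1 - α := by linarith
    positivity
  have hMnonneg : 0 ≤ M := mul_nonneg hC.le (integral_nonneg fun ω => by positivity)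
  refine ⟨2 * (K + M), by positivity, fun f a ha hf hbound => ?_⟩
  have hsmooth : ∀ j : ℕ, j ≤ 2 → ContDiff ℝ 1 (iteratedDeriv j f) := fun j hj =>
    iteratedDeriv_eq_iterate (n := j) (f := f) ▸
      ContDiff.iterate_deriv' 1 j (hf.of_le (by exact_mod_cast (by omega : 1 + j ≤ 3)))
  have hcont : ∀ j : ℕ, j ≤ 3 → Continuous (iteratedDeriv j f) := fun j hj =>
    hf.continuous_iteratedDeriv j (by exact_mod_cast hj)
  have hdecay : ∀ j : ℕ, j ≤ 3 → ∀ ω ≠ 0, ‖iteratedDeriv j f ω‖ ≤ C * |ω| ^ (-(α + j)) := by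
    intro j hj ω hω
    refine (hbound j hj ω).trans ?_
    rw [show -α - (j : ℝ) = -(α + j) by ring]
    exact mul_le_mul_of_nonneg_left
      (sqrt_one_add_sq_rpow_neg_le (by positivity) (abs_pos.mpr hω)) hC.le
  have hint : ∀ j : ℕ, 1 ≤ j → j ≤ 3 → Integrable (iteratedDeriv j f) := by
    intro j hj1 hj3
    have hj : (1 : ℝ) ≤ j := by exact_mod_cast hj1
    refine ((integrable_sqrt_one_add_sq_rpow_neg (s := α + j) (by linarith)).const_mul C).mono'
      (hcont j hj3).aestronglyMeasurable (Eventually.of_forall fun ω => ?_)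
    refine (hbound j hj3 ω).trans_eq ?_
    ring_nf
  have hlim : ∀ j : ℕ, j ≤ 3 → ∀ l : Filter ℝ, Tendsto (fun ω : ℝ => |ω|) l atTop →
      Tendsto (iteratedDeriv j f) l (nhds 0) := by
    intro j hj l hl
    have h := ((tendsto_rpow_neg_atTop (y := α + j) (by positivity)).comp hl).const_mul C
    rw [mul_zero] at h
    refine squeeze_zero_norm' ?_ h
    filter_upwards [hl.eventually_gt_atTop 0] with ω hω
    exact hdecay j hj ω (abs_pos.mp hω)
  have hparts : ∀ j : ℕ, 1 ≤ j → j ≤ 2 →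
      ∫ ω : ℝ, Complex.exp (Complex.I * (a : ℂ) * (ω : ℂ)) * iteratedDeriv j f ω =
      -(Complex.I * a)⁻¹ *
        ∫ ω : ℝ, Complex.exp (Complex.I * (a : ℂ) * (ω : ℂ)) * iteratedDeriv (j + 1) f ω := by
    intro j hj1 hj2
    rw [iteratedDeriv_succ]
    exact integral_exp_mul_eq_neg_inv_mul (hsmooth j hj2) (hint j hj1 (by omega))
      (by rw [← iteratedDeriv_succ]; exact hint (j + 1) (by omega) (by omega))
      (hlim j (by omega) _ tendsto_abs_atTop_atTop)
      (hlim j (by omega) _ tendsto_abs_atBot_atTop) ha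
  have htends := tendsto_integral_exp_mul_of_integrable_deriv (f := f)
    (by simpa using hsmooth 0 (by omega)) (by simpa using hint 1 le_rfl (by omega))
    (by simpa using hlim 0 (by omega) _ tendsto_abs_atTop_atTop)
    (by simpa using hlim 0 (by omega) _ tendsto_abs_atBot_atTop) ha
  refine ⟨_, htends, ?_⟩
  refine le_mul_rpow_mul_sqrt_rpow_neg_two hα0 hMnonneg hKpos.le ha ?_ ?_
  · refine le_of_tendsto htends.norm ?_
    filter_upwards [eventually_ge_atTop |a|⁻¹] with N hN
    refine norm_symmetric_integral_exp_mul_le_of_norm_le_rpow ⟨hα0, hα1⟩ hC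
      (by simpa using hsmooth 0 (by omega)) (fun ω hω => by simpa using hdecay 0 (by omega) ω hω)
      (fun ω hω => ?_) ha hN
    have h := hdecay 1 (by omega) ω hω
    rw [iteratedDeriv_one] at h
    refine h.trans_eq ?_
    push_cast
    ring_nf
  · rw [← iteratedDeriv_one, hparts 1 le_rfl (by omega), hparts 2 (by omega) le_rfl]
    simp only [norm_mul, norm_neg, norm_inv, Complex.norm_I, Complex.norm_real, Real.norm_eq_abs,
      one_mul]
    have h : ‖∫ ω : ℝ, Complex.exp (Complex.I * (a : ℂ) * (ω : ℂ)) * iteratedDeriv 3 f ω‖ ≤ M := by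
      rw [hM, ← integral_const_mul]
      refine norm_integral_le_of_norm_le
        ((integrable_sqrt_one_add_sq_rpow_neg (by linarith)).const_mul C)
        (Eventually.of_forall fun ω => ?_)
      rw [norm_mul, norm_exp_I_mul_ofReal_mul_ofReal, one_mul]
      refine (hbound 3 le_rfl ω).trans_eq ?_
      push_cast
      ring_nf
    calc _ = |a|⁻¹ ^ 3 *
          ‖∫ ω : ℝ, Complex.exp (Complex.I * (a : ℂ) * (ω : ℂ)) * iteratedDeriv 3 f ω‖ := by ring
      _ ≤ |a|⁻¹ ^ 3 * M := by gcongr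
      _ = M * |a|⁻¹ ^ 3 := mul_comm _ _
end

section
/- Let 0 < δ₁ < δ₀, and let χ ∈ C^∞(ℝ, [0,1]) satisfy χ(x) = 1 for |x| ≤ δ₁ and χ(x) = 0 for |x| ≥ δ₀. Let n ≥ 1 be an integer, C > 0, and let f ∈ C²(ℝ, ℂ) satisfy |f^{(j)}(ω)| ≤ C ⟨ω⟩^{−n−1−j} for j = 0, 1, 2 and all ω ∈ ℝ. Then there exists C' > 0, depending only on χ, n, and C, such that for all ρ ∈ (0,1) and all a ∈ ℝ: | ρ^{−n} ∫_ℝ (1 − χ(ρ⟨ω⟩)) e^{i a ω} f(ω) dω | ≤ C' ⟨a⟩^{−2}. -/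
open MeasureTheory Set

/-- Two integrations by parts: if `G` and its first two derivatives are dominated by an integrable
function `B`, then `∫ e^{iaω} G(ω) dω` decays quadratically in `a`. -/
theorem norm_integral_exp_mul_le_of_deriv_bounds {G G₁ G₂ : ℝ → ℂ} {B : ℝ → ℝ}
    (hG : ∀ x, HasDerivAt G (G₁ x) x) (hG₁ : ∀ x, HasDerivAt G₁ (G₂ x) x)
    (hG₂ : Continuous G₂) (hB : Integrable B)
    (b₀ : ∀ x, ‖G x‖ ≤ B x) (b₁ : ∀ x, ‖G₁ x‖ ≤ B x) (b₂ : ∀ x, ‖G₂ x‖ ≤ B x) (a : ℝ) :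
    (1 + a ^ 2) * ‖∫ x : ℝ, Complex.exp (Complex.I * (a : ℂ) * (x : ℂ)) * G x‖
      ≤ 2 * ∫ x, B x := by
  set e : ℝ → ℂ := fun x => Complex.exp (Complex.I * (a : ℂ) * (x : ℂ)) with he
  have hce : Continuous e := by fun_prop
  have hne : ∀ x, ‖e x‖ = 1 := fun x => by
    have : Complex.I * (a : ℂ) * (x : ℂ) = ((a * x : ℝ) : ℂ) * Complex.I := by push_cast; ring
    rw [he]; simp only [this, Complex.norm_exp_ofReal_mul_I]
  have hde : ∀ x, HasDerivAt e (Complex.I * a * e x) x := fun x => by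
    have h1 : HasDerivAt (fun x : ℝ => Complex.I * (a : ℂ) * (x : ℂ)) (Complex.I * a * 1) x :=
      (Complex.ofRealCLM.hasDerivAt (x := x)).const_mul _
    convert h1.cexp using 1
    simp only [he]; ring
  have hint : ∀ F : ℝ → ℂ, Continuous F → (∀ x, ‖F x‖ ≤ B x) →
      Integrable (fun x => e x * F x) := fun F hF hb =>
    hB.mono' (hce.mul hF).aestronglyMeasurable
      (Filter.Eventually.of_forall fun x => by rw [norm_mul, hne, one_mul]; exact hb x)
  have hbound : ∀ F : ℝ → ℂ, (∀ x, ‖F x‖ ≤ B x) →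
      ‖∫ x, e x * F x‖ ≤ ∫ x, B x := fun F hb =>
    norm_integral_le_of_norm_le hB
      (Filter.Eventually.of_forall fun x => by rw [norm_mul, hne, one_mul]; exact hb x)
  have hparts : ∀ F F' : ℝ → ℂ, (∀ x, HasDerivAt F (F' x) x) → Continuous F' →
      (∀ x, ‖F x‖ ≤ B x) → (∀ x, ‖F' x‖ ≤ B x) →
      ∫ x, e x * F' x = -(Complex.I * a * ∫ x, e x * F x) := by
    intro F F' hF hF' hb hb'
    have hFc : Continuous F := continuous_iff_continuousAt.2 fun x => (hF x).continuousAt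
    have hi := hint F hFc hb
    have key := integral_mul_deriv_eq_deriv_mul_of_integrable
      (u := e) (v := F) (fun x _ => hde x) (fun x _ => hF x) (hint F' hF' hb')
      ((hi.const_mul (Complex.I * a)).congr
        (Filter.Eventually.of_forall fun x => by simp only [Pi.mul_apply]; ring)) hi
    rw [key, ← integral_const_mul]
    simp only [mul_assoc]
  have hG₁c : Continuous G₁ := continuous_iff_continuousAt.2 fun x => (hG₁ x).continuousAt
  have h2 : ∫ x, e x * G₂ x = -((a : ℂ) ^ 2 * ∫ x, e x * G x) := by
    rw [hparts G₁ G₂ hG₁ hG₂ b₁ b₂, hparts G G₁ hG hG₁c b₀ b₁]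
    linear_combination ((a : ℂ) ^ 2 * ∫ x, e x * G x) * Complex.I_sq
  have h3 : a ^ 2 * ‖∫ x, e x * G x‖ = ‖∫ x, e x * G₂ x‖ := by
    rw [h2, norm_neg, norm_mul, norm_pow, Complex.norm_real, Real.norm_eq_abs, sq_abs]
  have h4 := hbound G b₀
  have h5 := hbound G₂ b₂
  linarith

theorem one_le_sqrt_one_add_sq (x : ℝ) : 1 ≤ √(1 + x ^ 2) :=
  Real.one_le_sqrt.2 (by nlinarith [sq_nonneg x])

theorem hasDerivAt_sqrt_one_add_sq (x : ℝ) :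
    HasDerivAt (fun x : ℝ => √(1 + x ^ 2)) (x / √(1 + x ^ 2)) x := by
  have h : HasDerivAt (fun x : ℝ => 1 + x ^ 2) (2 * x) x := by
    simpa using (hasDerivAt_pow 2 x).const_add 1
  convert h.sqrt (by positivity) using 1
  field_simp

theorem hasDerivAt_div_sqrt_one_add_sq (x : ℝ) :
    HasDerivAt (fun x : ℝ => x / √(1 + x ^ 2)) ((√(1 + x ^ 2) ^ 3)⁻¹) x := by
  have hw : √(1 + x ^ 2) ≠ 0 := by positivity
  have hw2 : √(1 + x ^ 2) ^ 2 = 1 + x ^ 2 := Real.sq_sqrt (by positivity)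
  refine ((hasDerivAt_id' x).fun_div (hasDerivAt_sqrt_one_add_sq x) hw).congr_deriv ?_
  field_simp
  linear_combination hw2

theorem abs_div_sqrt_one_add_sq_le (x : ℝ) : |x / √(1 + x ^ 2)| ≤ 1 := by
  rw [abs_div, abs_of_pos (show 0 < √(1 + x ^ 2) by positivity), div_le_one (by positivity)]
  exact Real.abs_le_sqrt (by linarith)

/-- On the region `δ ≤ ρ⟨x⟩`, the singular factor `ρ^{-n}` is absorbed into a rescaled Cauchy
density. -/
theorem inv_sqrt_pow_le_of_le_mul_sqrt {δ ρ : ℝ} (hδ : 0 < δ) (hρ : 0 < ρ) (m : ℕ) (x : ℝ)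
    (h : δ ≤ ρ * √(1 + x ^ 2)) :
    (√(1 + x ^ 2) ^ (m + 2))⁻¹
      ≤ ρ ^ (m + 1) * (ρ * (((1 + (δ ^ 2)⁻¹) / δ ^ m) * (1 + (ρ * x) ^ 2)⁻¹)) := by
  have hw2 : √(1 + x ^ 2) ^ 2 = 1 + x ^ 2 := Real.sq_sqrt (by positivity)
  have hw : 0 < √(1 + x ^ 2) := by positivity
  set w := √(1 + x ^ 2)
  have h1 : δ ^ m ≤ (ρ * w) ^ m := pow_le_pow_left₀ hδ.le h m
  have h2 : δ ^ 2 ≤ (ρ * w) ^ 2 := pow_le_pow_left₀ hδ.le h 2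
  have h3 : 1 + (ρ * x) ^ 2 ≤ (1 + (δ ^ 2)⁻¹) * (ρ * w) ^ 2 := by
    have h4 : 1 ≤ (δ ^ 2)⁻¹ * (ρ * w) ^ 2 := by
      rw [inv_mul_eq_div, one_le_div (by positivity)]; exact h2
    nlinarith [sq_nonneg ρ]
  have h5 : δ ^ m * (1 + (ρ * x) ^ 2) ≤ (ρ * w) ^ m * ((1 + (δ ^ 2)⁻¹) * (ρ * w) ^ 2) :=
    mul_le_mul h1 h3 (by positivity) (by positivity)
  have h6 : ρ ^ (m + 1) * (ρ * (((1 + (δ ^ 2)⁻¹) / δ ^ m) * (1 + (ρ * x) ^ 2)⁻¹))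
      = (ρ ^ (m + 2) * (1 + (δ ^ 2)⁻¹)) / (δ ^ m * (1 + (ρ * x) ^ 2)) := by
    rw [← div_eq_mul_inv, div_div]; ring
  rw [h6, inv_eq_one_div, div_le_div_iff₀ (by positivity) (by positivity), one_mul]
  refine h5.trans (le_of_eq ?_)
  ring

/-- The first two derivatives of a smooth compactly supported function which is constant near the
origin are bounded, and vanish near the origin. -/
theorem exists_bound_deriv_of_cutoff {δ₁ δ₀ : ℝ} {χ : ℝ → ℝ}
    (hχ : ContDiff ℝ (⊤ : ℕ∞) χ) (hone : ∀ x : ℝ, |x| ≤ δ₁ → χ x = 1)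
    (hzero : ∀ x : ℝ, δ₀ ≤ |x| → χ x = 0) :
    ∃ M : ℝ, 1 ≤ M ∧ (∀ x, |deriv χ x| ≤ M) ∧ (∀ x, |deriv (deriv χ) x| ≤ M) ∧
      (∀ x, |x| < δ₁ → deriv χ x = 0) ∧ (∀ x, |x| < δ₁ → deriv (deriv χ) x = 0) := by
  have hsupp : HasCompactSupport χ :=
    HasCompactSupport.intro (isCompact_Icc (a := -δ₀) (b := δ₀)) fun x hx => hzero x <| by
      by_contra! h
      exact hx (abs_le.1 h.le)
  have hd1 : ContDiff ℝ 1 (deriv χ) := ContDiff.deriv' (contDiff_infty.1 hχ 2)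
  have hd2 : Continuous (deriv (deriv χ)) := hd1.continuous_deriv le_rfl
  obtain ⟨M₁, h₁⟩ := hsupp.deriv.exists_bound_of_continuous hd1.continuous
  obtain ⟨M₂, h₂⟩ := hsupp.deriv.deriv.exists_bound_of_continuous hd2
  have hopen : IsOpen {x : ℝ | |x| < δ₁} := isOpen_lt continuous_abs continuous_const
  have hz1 : ∀ x, |x| < δ₁ → deriv χ x = 0 := fun x hx => by
    have : χ =ᶠ[nhds x] fun _ => 1 :=
      Filter.eventually_of_mem (hopen.mem_nhds hx) fun y hy => hone y (le_of_lt hy)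
    rw [this.deriv_eq, deriv_const]
  refine ⟨max 1 (max M₁ M₂), le_max_left _ _, fun x => (h₁ x).trans (by simp),
    fun x => (h₂ x).trans (by simp), hz1, fun x hx => ?_⟩
  have : deriv χ =ᶠ[nhds x] fun _ => 0 :=
    Filter.eventually_of_mem (hopen.mem_nhds hx) hz1
  rw [this.deriv_eq, deriv_const]

/-- Non-oscillatory kernel bound with cutoff: for a smooth cutoff `χ` (`= 1` on
`|x| ≤ δ₁`, `= 0` on `|x| ≥ δ₀`), `n ≥ 1`, and `f` with `|f⁽ʲ⁾(ω)| ≤ C⟨ω⟩^{-n-1-j}`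
for `j = 0,1,2`, one has
`|ρ^{-n} ∫_ℝ (1-χ(ρ⟨ω⟩)) e^{iaω} f(ω) dω| ≤ C'⟨a⟩^{-2}` for all `ρ ∈ (0,1)`, `a ∈ ℝ`,
with `C'` depending only on `χ`, `n`, `C`. -/
theorem cutoff_kernel_bound
    (δ₁ δ₀ : ℝ) (hδ₁ : 0 < δ₁) (hδ : δ₁ < δ₀) (χ : ℝ → ℝ)
    (hχsmooth : ContDiff ℝ (⊤ : ℕ∞) χ) (hχrange : ∀ x : ℝ, χ x ∈ Icc (0:ℝ) 1)
    (hχone : ∀ x : ℝ, |x| ≤ δ₁ → χ x = 1) (hχzero : ∀ x : ℝ, δ₀ ≤ |x| → χ x = 0)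
    (n : ℕ) (hn : 1 ≤ n) (C : ℝ) (hC : 0 < C) :
    ∃ C' > (0:ℝ), ∀ f : ℝ → ℂ, ContDiff ℝ 2 f →
      (∀ j : ℕ, j ≤ 2 → ∀ ω : ℝ,
        ‖iteratedDeriv j f ω‖ ≤ C * Real.sqrt (1 + ω^2) ^ (-(n:ℝ) - 1 - (j:ℝ))) →
      ∀ ρ ∈ Ioo (0:ℝ) 1, ∀ a : ℝ,
        ‖((ρ:ℂ)^n)⁻¹ * ∫ ω : ℝ,
            ((1 - χ (ρ * Real.sqrt (1 + ω^2)) : ℝ) : ℂ)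
              * Complex.exp (Complex.I * (a:ℂ) * (ω:ℂ)) * f ω‖
          ≤ C' * Real.sqrt (1 + a^2) ^ (-(2:ℝ)) := by
  obtain ⟨M, hM1, hM', hM'', hz', hz''⟩ := exists_bound_deriv_of_cutoff hχsmooth hχone hχzero
  obtain ⟨m, rfl⟩ : ∃ m, n = m + 1 := ⟨n - 1, by omega⟩
  have hd1 : ContDiff ℝ 1 (deriv χ) := ContDiff.deriv' (contDiff_infty.1 hχsmooth 2)
  have hd2 : Continuous (deriv (deriv χ)) := hd1.continuous_deriv le_rfl
  have hχd : ∀ x, HasDerivAt χ (deriv χ x) x := fun x =>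
    (hχsmooth.differentiable (by simp) x).hasDerivAt
  have hχdd : ∀ x, HasDerivAt (deriv χ) (deriv (deriv χ) x) x := fun x =>
    (hd1.differentiable (by simp) x).hasDerivAt
  set K : ℝ := (1 + (δ₁ ^ 2)⁻¹) / δ₁ ^ m with hK
  have hKpos : 0 < K := by positivity
  have hMpos : 0 < M := by linarith
  refine ⟨2 * (5 * M * C * K * Real.pi), by positivity, fun f hf hfb ρ hρ a => ?_⟩
  obtain ⟨hρ0, hρ1⟩ := hρ
  have hf1 : ContDiff ℝ 1 (deriv f) := hf.deriv'
  have hf2 : Continuous (deriv (deriv f)) := hf1.continuous_deriv le_rfl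
  have hfd : ∀ x, HasDerivAt f (deriv f x) x := fun x =>
    (hf.differentiable (by simp) x).hasDerivAt
  have hfdd : ∀ x, HasDerivAt (deriv f) (deriv (deriv f) x) x := fun x =>
    (hf1.differentiable (by simp) x).hasDerivAt
  have hfbound : ∀ j : ℕ, j ≤ 2 → ∀ x, ‖iteratedDeriv j f x‖ ≤ C * (√(1 + x ^ 2) ^ (m + 2))⁻¹ := by
    intro j hj x
    refine (hfb j hj x).trans ?_
    gcongr
    rw [← Real.rpow_natCast _ (m + 2), ← Real.rpow_neg (by positivity)]
    refine Real.rpow_le_rpow_of_exponent_le (one_le_sqrt_one_add_sq x) ?_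
    have : (0 : ℝ) ≤ j := j.cast_nonneg
    push_cast
    linarith
  have hfb0 : ∀ x, ‖f x‖ ≤ C * (√(1 + x ^ 2) ^ (m + 2))⁻¹ := by
    simpa using hfbound 0 (by norm_num)
  have hfb1 : ∀ x, ‖deriv f x‖ ≤ C * (√(1 + x ^ 2) ^ (m + 2))⁻¹ := by
    simpa [iteratedDeriv_one] using hfbound 1 (by norm_num)
  have hfb2 : ∀ x, ‖deriv (deriv f) x‖ ≤ C * (√(1 + x ^ 2) ^ (m + 2))⁻¹ := by
    simpa [iteratedDeriv_succ, iteratedDeriv_one] using hfbound 2 le_rfl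
  set h : ℝ → ℝ := fun x => 1 - χ (ρ * √(1 + x ^ 2)) with hh
  set h₁ : ℝ → ℝ := fun x => -(deriv χ (ρ * √(1 + x ^ 2)) * (ρ * (x / √(1 + x ^ 2)))) with hh₁
  set h₂ : ℝ → ℝ := fun x =>
    -(deriv (deriv χ) (ρ * √(1 + x ^ 2)) * (ρ * (x / √(1 + x ^ 2))) * (ρ * (x / √(1 + x ^ 2)))
      + deriv χ (ρ * √(1 + x ^ 2)) * (ρ * (√(1 + x ^ 2) ^ 3)⁻¹)) with hh₂
  have hdw : ∀ x, HasDerivAt (fun x : ℝ => ρ * √(1 + x ^ 2)) (ρ * (x / √(1 + x ^ 2))) x :=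
    fun x => (hasDerivAt_sqrt_one_add_sq x).const_mul ρ
  have hdh : ∀ x, HasDerivAt h (h₁ x) x := fun x =>
    ((hχd _).comp x (hdw x)).const_sub 1
  have hdh₁ : ∀ x, HasDerivAt h₁ (h₂ x) x := fun x =>
    (((hχdd _).comp x (hdw x)).mul ((hasDerivAt_div_sqrt_one_add_sq x).const_mul ρ)).neg
  have hwne : ∀ x : ℝ, √(1 + x ^ 2) ≠ 0 := fun x => by positivity
  have hwne3 : ∀ x : ℝ, √(1 + x ^ 2) ^ 3 ≠ 0 := fun x => pow_ne_zero 3 (hwne x)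
  have hch₂ : Continuous h₂ := by
    have := hd1.continuous
    have hcw : Continuous fun x : ℝ => √(1 + x ^ 2) := by fun_prop
    have hcq : Continuous fun x : ℝ => x / √(1 + x ^ 2) := continuous_id.div hcw hwne
    have hci : Continuous fun x : ℝ => (√(1 + x ^ 2) ^ 3)⁻¹ := (hcw.pow 3).inv₀ hwne3
    fun_prop
  have hq : ∀ x : ℝ, |ρ * (x / √(1 + x ^ 2))| ≤ 1 := fun x => by
    rw [abs_mul, abs_of_pos hρ0]
    exact mul_le_one₀ hρ1.le (abs_nonneg _) (abs_div_sqrt_one_add_sq_le x)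
  have hr : ∀ x : ℝ, |ρ * (√(1 + x ^ 2) ^ 3)⁻¹| ≤ 1 := fun x => by
    rw [abs_mul, abs_of_pos hρ0, abs_of_pos (by positivity)]
    exact mul_le_one₀ hρ1.le (by positivity)
      (inv_le_one_of_one_le₀ (one_le_pow₀ (one_le_sqrt_one_add_sq x)))
  have hbh : ∀ x, |h x| ≤ M := fun x => by
    have := hχrange (ρ * √(1 + x ^ 2))
    rw [abs_le]; constructor <;> simp only [hh] <;> linarith [this.1, this.2]
  have hbh₁ : ∀ x, |h₁ x| ≤ M := fun x => by
    rw [hh₁, abs_neg, abs_mul]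
    exact (mul_le_mul (hM' _) (hq x) (abs_nonneg _) hMpos.le).trans_eq (mul_one M)
  have hbh₂ : ∀ x, |h₂ x| ≤ 2 * M := fun x => by
    rw [hh₂, abs_neg]
    refine (abs_add_le _ _).trans ?_
    rw [abs_mul, abs_mul, abs_mul (deriv χ _), two_mul]
    have e1 := (mul_le_mul (hM'' (ρ * √(1 + x ^ 2))) (hq x) (abs_nonneg _) hMpos.le)
    have e2 := mul_le_mul e1 (hq x) (abs_nonneg _) (by linarith)
    have e3 := (mul_le_mul (hM' (ρ * √(1 + x ^ 2))) (hr x) (abs_nonneg _) hMpos.le)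
    linarith
  set B : ℝ → ℝ := fun x => 5 * M * C * (ρ ^ (m + 1) * (ρ * (K * (1 + (ρ * x) ^ 2)⁻¹))) with hB
  have hBi : Integrable B :=
    ((((integrable_inv_one_add_sq.comp_mul_left' hρ0.ne').const_mul K).const_mul
      ρ).const_mul (ρ ^ (m + 1))).const_mul (5 * M * C)
  have hBint : ∫ x, B x = ρ ^ (m + 1) * (5 * M * C * K * Real.pi) := by
    simp only [hB, integral_const_mul]
    rw [Measure.integral_comp_mul_left (fun y : ℝ => (1 + y ^ 2)⁻¹) ρ,
      integral_univ_inv_one_add_sq, abs_of_pos (inv_pos.2 hρ0), smul_eq_mul]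
    field_simp
  -- Outside the region `δ₁ ≤ ρ⟨x⟩` the cutoff and its derivatives vanish.
  have hdom : ∀ (x : ℝ) (z : ℂ), (h x = 0 → h₁ x = 0 → h₂ x = 0 → z = 0) →
      ‖z‖ ≤ 5 * M * (C * (√(1 + x ^ 2) ^ (m + 2))⁻¹) → ‖z‖ ≤ B x := by
    intro x z hz hzb
    rcases le_or_gt δ₁ (ρ * √(1 + x ^ 2)) with hx | hx
    · refine hzb.trans ?_
      rw [hB, ← mul_assoc]
      exact mul_le_mul_of_nonneg_left (inv_sqrt_pow_le_of_le_mul_sqrt hδ₁ hρ0 m x hx)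
        (by positivity)
    · have habs : |ρ * √(1 + x ^ 2)| < δ₁ := by rwa [abs_of_pos (by positivity)]
      rw [hz (by simp [hh, hχone _ habs.le]) (by simp [hh₁, hz' _ habs])
        (by simp [hh₂, hz' _ habs, hz'' _ habs]), norm_zero]
      positivity
  have hsm : ∀ (r L : ℝ) (z : ℂ) (x : ℝ), |r| ≤ L → ‖z‖ ≤ C * (√(1 + x ^ 2) ^ (m + 2))⁻¹ →
      ‖r • z‖ ≤ L * (C * (√(1 + x ^ 2) ^ (m + 2))⁻¹) := fun r L z x hr hz => by
    rw [norm_smul, Real.norm_eq_abs]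
    exact mul_le_mul hr hz (norm_nonneg _) ((abs_nonneg _).trans hr)
  have hpos : ∀ x : ℝ, 0 ≤ M * (C * (√(1 + x ^ 2) ^ (m + 2))⁻¹) := fun x => by positivity
  have hcf := hf.continuous
  have hcf1 := hf1.continuous
  have hch : Continuous h := continuous_iff_continuousAt.2 fun x => (hdh x).continuousAt
  have hch₁ : Continuous h₁ := continuous_iff_continuousAt.2 fun x => (hdh₁ x).continuousAt
  have main := norm_integral_exp_mul_le_of_deriv_bounds
    (G := fun x => h x • f x) (G₁ := fun x => h x • deriv f x + h₁ x • f x)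
    (G₂ := fun x => (h x • deriv (deriv f) x + h₁ x • deriv f x)
      + (h₁ x • deriv f x + h₂ x • f x)) (B := B)
    (fun x => (hdh x).smul (hfd x))
    (fun x => ((hdh x).smul (hfdd x)).add ((hdh₁ x).smul (hfd x)))
    (by fun_prop) hBi
    (fun x => hdom x _ (fun e _ _ => by simp [e])
      (by linarith [hsm _ _ _ x (hbh x) (hfb0 x), hpos x]))
    (fun x => hdom x _ (fun e e₁ _ => by simp [e, e₁])
      (by linarith [hsm _ _ _ x (hbh x) (hfb1 x), hsm _ _ _ x (hbh₁ x) (hfb0 x), hpos x,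
            norm_add_le (h x • deriv f x) (h₁ x • f x)]))
    (fun x => hdom x _ (fun e e₁ e₂ => by simp [e, e₁, e₂])
      (by linarith [hsm _ _ _ x (hbh x) (hfb2 x), hsm _ _ _ x (hbh₁ x) (hfb1 x),
            hsm _ _ _ x (hbh₂ x) (hfb0 x), hpos x,
            norm_add_le (h x • deriv (deriv f) x) (h₁ x • deriv f x),
            norm_add_le (h₁ x • deriv f x) (h₂ x • f x),
            norm_add_le (h x • deriv (deriv f) x + h₁ x • deriv f x)
              (h₁ x • deriv f x + h₂ x • f x)]))
    a
  rw [hBint] at main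
  have hcongr : ∫ ω : ℝ, ((h ω : ℝ) : ℂ) * Complex.exp (Complex.I * (a:ℂ) * (ω:ℂ)) * f ω
      = ∫ x : ℝ, Complex.exp (Complex.I * (a : ℂ) * (x : ℂ)) * (h x • f x) := by
    refine integral_congr_ae (Filter.Eventually.of_forall fun x => ?_)
    simp only [Complex.real_smul]
    ring
  have hpow : √(1 + a ^ 2) ^ (-(2 : ℝ)) = (1 + a ^ 2)⁻¹ := by
    rw [Real.rpow_neg (Real.sqrt_nonneg _), Real.rpow_two, Real.sq_sqrt (by positivity)]
  change ‖((ρ:ℂ)^(m + 1))⁻¹ *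
    ∫ ω : ℝ, ((h ω : ℝ) : ℂ) * Complex.exp (Complex.I * (a:ℂ) * (ω:ℂ)) * f ω‖ ≤ _
  rw [hcongr, hpow, norm_mul, norm_inv, norm_pow, Complex.norm_real, Real.norm_eq_abs,
    abs_of_pos hρ0, ← div_eq_mul_inv, le_div_iff₀ (by positivity), inv_mul_eq_div,
    div_mul_eq_mul_div, div_le_iff₀ (by positivity)]
  linarith
end

section
/- There exists a constant C > 0 such that for every f ∈ C¹([0,1], ℂ): ( ∫₀¹ |f(ρ)|⁵ ρ⁹ dρ )^{1/5} ≤ C ( ∫₀¹ |f'(ρ)|² ρ⁴ dρ + ∫₀¹ |f(ρ)|² ρ⁴ dρ )^{1/2}. Equivalently, ‖(·) f‖_{L⁵(𝔹⁵)} ≲ ‖f‖_{H¹(𝔹⁵)}, with constant independent of f. -/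
open Set

/-- Bound on minus the derivative of `‖f‖² t³`, where `z` and `w` are the values of `f` and its
derivative at `t`. -/
lemma neg_weighted_deriv_le (z w : ℂ) (t : ℝ) :
    -(2 * inner ℝ z w * t ^ 3 + ‖z‖ ^ 2 * (3 * t ^ 2)) ≤ ‖w‖ ^ 2 * t ^ 4 := by
  have h := sq_nonneg (‖z + t • w‖)
  rw [norm_add_sq_real, inner_smul_right, norm_smul, mul_pow, Real.norm_eq_abs, sq_abs] at h
  nlinarith [mul_nonneg (sq_nonneg t) h, mul_nonneg (sq_nonneg t) (sq_nonneg ‖z‖)]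

/-- Bound on the derivative of `‖f‖² t⁵`, where `z` and `w` are the values of `f` and its
derivative at `t`. -/
lemma weighted_deriv_le (z w : ℂ) {t : ℝ} (ht₀ : 0 ≤ t) (ht₁ : t ≤ 1) :
    2 * inner ℝ z w * t ^ 5 + ‖z‖ ^ 2 * (5 * t ^ 4) ≤
      ‖w‖ ^ 2 * t ^ 4 + 6 * (‖z‖ ^ 2 * t ^ 4) := by
  have h := sq_nonneg (‖z - w‖)
  rw [norm_sub_sq_real] at h
  have h₁ : t ^ 5 ≤ t ^ 4 := pow_le_pow_of_le_one ht₀ ht₁ (by norm_num)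
  have h₂ : 0 ≤ t ^ 5 := by positivity
  nlinarith [mul_nonneg h₂ h, mul_nonneg (sub_nonneg.2 h₁)
    (add_nonneg (sq_nonneg ‖z‖) (sq_nonneg ‖w‖))]

lemma hasDerivAt_norm_sq_mul_pow {f : ℝ → ℂ} {z : ℂ} {t : ℝ} (h : HasDerivAt f z t) (n : ℕ) :
    HasDerivAt (fun s ↦ ‖f s‖ ^ 2 * s ^ n)
      (2 * inner ℝ (f t) z * t ^ n + ‖f t‖ ^ 2 * (n * t ^ (n - 1))) t :=
  h.norm_sq.mul (hasDerivAt_pow n t)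

section

variable {f f' : ℝ → ℂ}

lemma intervalIntegrable_norm_pow_mul_pow (hf : ContinuousOn f (Icc (0 : ℝ) 1)) (m n : ℕ)
    {a : ℝ} (ha : a ∈ Icc (0 : ℝ) 1) :
    IntervalIntegrable (fun s ↦ ‖f s‖ ^ m * s ^ n) MeasureTheory.volume a 1 := by
  apply ContinuousOn.intervalIntegrable
  rw [uIcc_of_le ha.2]
  exact ((hf.norm.pow m).mul (continuousOn_id.pow n)).mono (Icc_subset_Icc_left ha.1)

/-- The trace at the boundary of the ball is controlled by the radial `H¹(𝔹⁵)` norm. -/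
lemma norm_sq_one_le
    (hf : ∀ ρ ∈ Icc (0 : ℝ) 1, HasDerivWithinAt f (f' ρ) (Icc (0 : ℝ) 1) ρ)
    (hf' : ContinuousOn f' (Icc (0 : ℝ) 1)) :
    ‖f 1‖ ^ 2 ≤ (∫ ρ in (0 : ℝ)..1, ‖f' ρ‖ ^ 2 * ρ ^ 4)
      + 6 * ∫ ρ in (0 : ℝ)..1, ‖f ρ‖ ^ 2 * ρ ^ 4 := by
  have hc : ContinuousOn f (Icc (0 : ℝ) 1) := fun x hx ↦ (hf x hx).continuousWithinAt
  have h0 : (0 : ℝ) ∈ Icc (0 : ℝ) 1 := by simp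
  have hi' := intervalIntegrable_norm_pow_mul_pow hf' 2 4 h0
  have hi := (intervalIntegrable_norm_pow_mul_pow hc 2 4 h0).const_mul 6
  have key := intervalIntegral.sub_le_integral_of_hasDeriv_right_of_le (zero_le_one' ℝ)
    ((hc.norm.pow 2).mul (continuousOn_id.pow 5))
    (fun x hx ↦ (hasDerivAt_norm_sq_mul_pow
      ((hf x (Ioo_subset_Icc_self hx)).hasDerivAt (Icc_mem_nhds hx.1 hx.2)) 5).hasDerivWithinAt)
    ((intervalIntegrable_iff_integrableOn_Icc_of_le zero_le_one).1 (hi'.add hi))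
    (fun x hx ↦ by simpa using weighted_deriv_le (f x) (f' x) hx.1.le hx.2.le)
  rw [← intervalIntegral.integral_const_mul, ← intervalIntegral.integral_add hi' hi]
  simpa using key

/-- Radial pointwise decay estimate for functions in `H¹(𝔹⁵)`. -/
lemma norm_sq_mul_cube_le
    (hf : ∀ ρ ∈ Icc (0 : ℝ) 1, HasDerivWithinAt f (f' ρ) (Icc (0 : ℝ) 1) ρ)
    (hf' : ContinuousOn f' (Icc (0 : ℝ) 1)) {a : ℝ} (ha : a ∈ Icc (0 : ℝ) 1) :
    ‖f a‖ ^ 2 * a ^ 3 ≤ ‖f 1‖ ^ 2 + ∫ ρ in (0 : ℝ)..1, ‖f' ρ‖ ^ 2 * ρ ^ 4 := by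
  have hc : ContinuousOn f (Icc (0 : ℝ) 1) := fun x hx ↦ (hf x hx).continuousWithinAt
  have h0 : (0 : ℝ) ∈ Icc (0 : ℝ) 1 := by simp
  have key := intervalIntegral.sub_le_integral_of_hasDeriv_right_of_le ha.2
    ((((hc.norm.pow 2).mul (continuousOn_id.pow 3)).mono (Icc_subset_Icc_left ha.1)).neg)
    (fun x hx ↦ (hasDerivAt_norm_sq_mul_pow
      ((hf x ⟨ha.1.trans hx.1.le, hx.2.le⟩).hasDerivAt
        (Icc_mem_nhds (ha.1.trans_lt hx.1) hx.2)) 3).neg.hasDerivWithinAt)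
    ((intervalIntegrable_iff_integrableOn_Icc_of_le ha.2).1
      (intervalIntegrable_norm_pow_mul_pow hf' 2 4 ha))
    (fun x _ ↦ by simpa using neg_weighted_deriv_le (f x) (f' x) x)
  have hmono : ∫ ρ in a..1, ‖f' ρ‖ ^ 2 * ρ ^ 4 ≤ ∫ ρ in (0 : ℝ)..1, ‖f' ρ‖ ^ 2 * ρ ^ 4 :=
    intervalIntegral.integral_mono_interval ha.1 ha.2 le_rfl
      (Filter.Eventually.of_forall fun x ↦ by positivity)
      (intervalIntegrable_norm_pow_mul_pow hf' 2 4 h0)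
  simp at key
  linarith

end

/-- Weighted Sobolev-type inequality: there is `C > 0` such that for every
`f ∈ C¹([0,1],ℂ)`,
`(∫₀¹ |f|⁵ ρ⁹ dρ)^{1/5} ≤ C (∫₀¹ |f'|² ρ⁴ dρ + ∫₀¹ |f|² ρ⁴ dρ)^{1/2}`,
i.e. `‖(·) f‖_{L⁵(𝔹⁵)} ≲ ‖f‖_{H¹(𝔹⁵)}`. -/
theorem radial_weighted_sobolev :
    ∃ C > (0:ℝ), ∀ (f f' : ℝ → ℂ),
      (∀ ρ ∈ Icc (0:ℝ) 1, HasDerivWithinAt f (f' ρ) (Icc (0:ℝ) 1) ρ) →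
      ContinuousOn f' (Icc (0:ℝ) 1) →
      (∫ ρ in (0:ℝ)..1, ‖f ρ‖^5 * ρ^9) ^ ((1:ℝ)/5) ≤
        C * ((∫ ρ in (0:ℝ)..1, ‖f' ρ‖^2 * ρ^4)
          + (∫ ρ in (0:ℝ)..1, ‖f ρ‖^2 * ρ^4)) ^ ((1:ℝ)/2) := by
  refine ⟨√7, by positivity, fun f f' hf hf' ↦ ?_⟩
  have hc : ContinuousOn f (Icc (0 : ℝ) 1) := fun x hx ↦ (hf x hx).continuousWithinAt
  have h0 : (0 : ℝ) ∈ Icc (0 : ℝ) 1 := by simp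
  have htrace := norm_sq_one_le hf hf'
  have hdecay := fun a ↦ norm_sq_mul_cube_le hf hf' (a := a)
  have hA : 0 ≤ ∫ ρ in (0 : ℝ)..1, ‖f' ρ‖ ^ 2 * ρ ^ 4 :=
    intervalIntegral.integral_nonneg zero_le_one fun x _ ↦ by positivity
  have hB : 0 ≤ ∫ ρ in (0 : ℝ)..1, ‖f ρ‖ ^ 2 * ρ ^ 4 :=
    intervalIntegral.integral_nonneg zero_le_one fun x _ ↦ by positivity
  set A := ∫ ρ in (0 : ℝ)..1, ‖f' ρ‖ ^ 2 * ρ ^ 4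
  set B := ∫ ρ in (0 : ℝ)..1, ‖f ρ‖ ^ 2 * ρ ^ 4
  rw [← Real.sqrt_eq_rpow, ← Real.sqrt_mul (by norm_num)]
  set S := √(7 * (A + B))
  have hS : 0 ≤ S := Real.sqrt_nonneg _
  have hS2 : S ^ 2 = 7 * (A + B) := Real.sq_sqrt (by positivity)
  have hpt : ∀ x ∈ Icc (0 : ℝ) 1, ‖f x‖ ^ 5 * x ^ 9 ≤ S ^ 3 * (‖f x‖ ^ 2 * x ^ 4) := by
    intro x hx
    have hx₀ := hx.1
    have h₁ : ‖f x‖ ^ 2 * x ^ 3 ≤ S ^ 2 := by linarith [hdecay x hx]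
    have h₂ : ‖f x‖ ^ 3 * x ^ 5 ≤ S ^ 3 := by
      refine (sq_le_sq₀ (by positivity) (by positivity)).1 ?_
      calc (‖f x‖ ^ 3 * x ^ 5) ^ 2 = (‖f x‖ ^ 2 * x ^ 3) ^ 3 * x := by ring
        _ ≤ (‖f x‖ ^ 2 * x ^ 3) ^ 3 := mul_le_of_le_one_right (by positivity) hx.2
        _ ≤ (S ^ 2) ^ 3 := by gcongr
        _ = (S ^ 3) ^ 2 := by ring
    calc ‖f x‖ ^ 5 * x ^ 9 = ‖f x‖ ^ 3 * x ^ 5 * (‖f x‖ ^ 2 * x ^ 4) := by ring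
      _ ≤ S ^ 3 * (‖f x‖ ^ 2 * x ^ 4) := by gcongr
  have hint : ∫ ρ in (0 : ℝ)..1, ‖f ρ‖ ^ 5 * ρ ^ 9 ≤ S ^ 5 := by
    calc ∫ ρ in (0 : ℝ)..1, ‖f ρ‖ ^ 5 * ρ ^ 9
        ≤ ∫ ρ in (0 : ℝ)..1, S ^ 3 * (‖f ρ‖ ^ 2 * ρ ^ 4) :=
          intervalIntegral.integral_mono_on zero_le_one
            (intervalIntegrable_norm_pow_mul_pow hc 5 9 h0)
            ((intervalIntegrable_norm_pow_mul_pow hc 2 4 h0).const_mul _) hpt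
      _ = S ^ 3 * B := intervalIntegral.integral_const_mul _ _
      _ ≤ S ^ 3 * S ^ 2 := by gcongr; linarith
      _ = S ^ 5 := by ring
  have hnn : 0 ≤ ∫ ρ in (0 : ℝ)..1, ‖f ρ‖ ^ 5 * ρ ^ 9 :=
    intervalIntegral.integral_nonneg zero_le_one fun x hx ↦ by
      have := hx.1
      positivity
  calc (∫ ρ in (0 : ℝ)..1, ‖f ρ‖ ^ 5 * ρ ^ 9) ^ ((1 : ℝ) / 5)
      ≤ (S ^ 5) ^ ((1 : ℝ) / 5) := by gcongr
    _ = S := by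
      rw [one_div]
      exact_mod_cast Real.pow_rpow_inv_natCast hS (n := 5) (by norm_num)
end
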